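/- Every alternating parity GFG automaton A with n states is equivalent to a nondeterministic parity GFG automaton A^□ with 2^{O(nk log nk)} states, where k is the parity index of A. -/

import Mathlib

namespace GFGPaper

/-- Positive Boolean formulas over `Q`. -/
inductive PosBool (Q : Type) : Type
  | atom : Q → PosBool Q
  | band : PosBool Q → PosBool Q → PosBool Q
  | bor  : PosBool Q → PosBool Q → PosBool Q

/-- A (positional) choice of Eve inside a positive Boolean formula:
she resolves every disjunction (possibly differently in different conjuncts). -/
inductive EveChoice {Q : Type} : PosBool Q → Type
  | atom (q : Q) : EveChoice (PosBool.atom q)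
  | band {φ ψ : PosBool Q} : EveChoice φ → EveChoice ψ → EveChoice (PosBool.band φ ψ)
  | borl {φ ψ : PosBool Q} : EveChoice φ → EveChoice (PosBool.bor φ ψ)
  | borr {φ ψ : PosBool Q} : EveChoice ψ → EveChoice (PosBool.bor φ ψ)

/-- The atoms that Adam (resolving conjunctions) can reach against Eve's choice. -/
def EveChoice.outcome {Q : Type} : {φ : PosBool Q} → EveChoice φ → Set Q
  | _, .atom q => {q}
  | _, .band c d => c.outcome ∪ d.outcome
  | _, .borl c => c.outcome
  | _, .borr c => c.outcome

/-- A choice of Adam inside a positive Boolean formula: he resolves every conjunction. -/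
inductive AdamChoice {Q : Type} : PosBool Q → Type
  | atom (q : Q) : AdamChoice (PosBool.atom q)
  | bandl {φ ψ : PosBool Q} : AdamChoice φ → AdamChoice (PosBool.band φ ψ)
  | bandr {φ ψ : PosBool Q} : AdamChoice ψ → AdamChoice (PosBool.band φ ψ)
  | bor {φ ψ : PosBool Q} : AdamChoice φ → AdamChoice ψ → AdamChoice (PosBool.bor φ ψ)

/-- The atoms Eve (resolving disjunctions) can reach against Adam's choice. -/
def AdamChoice.outcome {Q : Type} : {φ : PosBool Q} → AdamChoice φ → Set Q
  | _, .atom q => {q}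
  | _, .bandl c => c.outcome
  | _, .bandr c => c.outcome
  | _, .bor c d => c.outcome ∪ d.outcome

/-- The unique atom reached when Eve plays `e` and Adam plays `a` on the same formula. -/
def resolve {Q : Type} : {φ : PosBool Q} → EveChoice φ → AdamChoice φ → Q
  | _, .atom q, _ => q
  | _, .band c _, .bandl e => resolve c e
  | _, .band _ d, .bandr e => resolve d e
  | _, .borl c, .bor e _ => resolve c e
  | _, .borr c, .bor _ f => resolve c f

def InfOften (p : ℕ → Prop) : Prop := ∀ N, ∃ n, N ≤ n ∧ p n

/-- The parity condition: the maximal priority occurring infinitely often is even. -/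
def ParityAcc (c : ℕ → ℕ) : Prop :=
  ∃ p, Even p ∧ InfOften (fun n => c n = p) ∧ ∀ q, p < q → ¬ InfOften (fun n => c n = q)

/-- An alternating automaton with an abstract acceptance condition on
infinite sequences of transitions. -/
structure AltAut (A Q : Type) where
  init : Q
  δ : Q → A → PosBool Q
  acc : (ℕ → Q × A × Q) → Prop

def trace {A Q : Type} (w : ℕ → A) (ρ : ℕ → Q) : ℕ → Q × A × Q :=
  fun n => (ρ n, w n, ρ (n + 1))

/-- Acceptance via the model-checking game: Eve has a (history-dependent)
strategy resolving the disjunctions such that every consistent path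
(i.e. every way for Adam to resolve the conjunctions) is accepting. -/
def AltAut.Accepts {A Q : Type} (M : AltAut A Q) (w : ℕ → A) : Prop :=
  ∃ σ : List Q → (n : ℕ) → (q : Q) → EveChoice (M.δ q (w n)),
    ∀ ρ : ℕ → Q, ρ 0 = M.init →
      (∀ n, ρ (n + 1) ∈ (σ (List.ofFn fun i : Fin n => ρ i.val) n (ρ n)).outcome) →
      M.acc (trace w ρ)

/-- Eve wins her letter game: she resolves disjunctions online (knowing only the
play so far) so that whenever the word Adam produces is in the language,
the constructed path is accepting. -/
def ExistsGFG {A Q : Type} (M : AltAut A Q) : Prop :=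
  ∃ σ : List (A × Q) → (a : A) → (q : Q) → EveChoice (M.δ q a),
    ∀ (w : ℕ → A) (ρ : ℕ → Q), ρ 0 = M.init →
      (∀ n, ρ (n + 1) ∈
        (σ (List.ofFn fun i : Fin n => (w i.val, ρ (i.val + 1))) (w n) (ρ n)).outcome) →
      M.Accepts w → M.acc (trace w ρ)

/-- Adam wins his letter game: he resolves conjunctions online so that whenever the
word is not in the language, the constructed path is rejecting. -/
def ForallGFG {A Q : Type} (M : AltAut A Q) : Prop :=
  ∃ τ : List (A × Q) → (a : A) → (q : Q) → AdamChoice (M.δ q a),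
    ∀ (w : ℕ → A) (ρ : ℕ → Q), ρ 0 = M.init →
      (∀ n, ρ (n + 1) ∈
        (τ (List.ofFn fun i : Fin n => (w i.val, ρ (i.val + 1))) (w n) (ρ n)).outcome) →
      M.Accepts w ∨ ¬ M.acc (trace w ρ)

/-- Eve wins her letter game with a strategy that is positional in the expanded
letter game, i.e. depends only on the word read so far and the current state. -/
def EveWinsPositional {A Q : Type} (M : AltAut A Q) : Prop :=
  ∃ σ : List A → (a : A) → (q : Q) → EveChoice (M.δ q a),
    ∀ (w : ℕ → A) (ρ : ℕ → Q), ρ 0 = M.init →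
      (∀ n, ρ (n + 1) ∈ (σ (List.ofFn fun i : Fin n => w i.val) (w n) (ρ n)).outcome) →
      M.Accepts w → M.acc (trace w ρ)

/-- Alternating parity automaton (priorities on transitions). -/
structure APW (A Q : Type) where
  init : Q
  δ : Q → A → PosBool Q
  prio : Q → A → Q → ℕ

def APW.toAlt {A Q : Type} (M : APW A Q) : AltAut A Q :=
  { init := M.init, δ := M.δ,
    acc := fun t => ParityAcc fun n => M.prio (t n).1 (t n).2.1 (t n).2.2 }

def APW.Accepts {A Q : Type} (M : APW A Q) (w : ℕ → A) : Prop := M.toAlt.Accepts w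

def PosBool.dual {Q : Type} : PosBool Q → PosBool Q
  | .atom q => .atom q
  | .band φ ψ => .bor φ.dual ψ.dual
  | .bor φ ψ => .band φ.dual ψ.dual

/-- The dual automaton: swap ∧/∨ and increase all priorities by one. -/
def APW.dual {A Q : Type} (M : APW A Q) : APW A Q :=
  { init := M.init, δ := fun q a => (M.δ q a).dual,
    prio := fun q a q' => M.prio q a q' + 1 }

/-- The box of a positional Eve strategy on the one-step arena over `a`. -/
def stratBox {A Q : Type} (δ : Q → A → PosBool Q) (a : A)
    (σ : (q : Q) → EveChoice (δ q a)) : Set (Q × A × Q) :=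
  { t | t.2.1 = a ∧ t.2.2 ∈ (σ t.1).outcome }

def BoxesAt {A Q : Type} (δ : Q → A → PosBool Q) (a : A) : Set (Set (Q × A × Q)) :=
  Set.range (stratBox δ a)

def Boxes {A Q : Type} (δ : Q → A → PosBool Q) : Set (Set (Q × A × Q)) :=
  ⋃ a, BoxesAt δ a

/-- A sequence of boxes is universally accepting if every path through it is accepting. -/
def UnivAcc {A Q : Type} (M : AltAut A Q) (β : ℕ → Set (Q × A × Q)) : Prop :=
  ∀ (ρ : ℕ → Q) (wa : ℕ → A), ρ 0 = M.init →
    (∀ n, (ρ n, wa n, ρ (n + 1)) ∈ β n) →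
    M.acc (fun n => (ρ n, wa n, ρ (n + 1)))

/-- Deterministic parity automaton (priorities on transitions). -/
structure DPA (A P : Type) where
  init : P
  step : P → A → P
  prio : P → A → ℕ

def DPA.run {A P : Type} (D : DPA A P) (w : ℕ → A) : ℕ → P
  | 0 => D.init
  | n + 1 => D.step (DPA.run D w n) (w n)

def DPA.Accepts {A P : Type} (D : DPA A P) (w : ℕ → A) : Prop :=
  ParityAcc fun n => D.prio (D.run w n) (w n)

def pref {A : Type} (w : ℕ → A) (n : ℕ) : List A := List.ofFn fun i : Fin n => w i.val

/-- Nondeterministic parity automaton. -/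
structure NPA (A P : Type) where
  init : P
  Δ : P → A → Set P
  prio : P → A → P → ℕ

def NPA.IsRun {A P : Type} (N : NPA A P) (w : ℕ → A) (ρ : ℕ → P) : Prop :=
  ρ 0 = N.init ∧ ∀ n, ρ (n + 1) ∈ N.Δ (ρ n) (w n)

def NPA.Accepts {A P : Type} (N : NPA A P) (w : ℕ → A) : Prop :=
  ∃ ρ, N.IsRun w ρ ∧ ParityAcc fun n => N.prio (ρ n) (w n) (ρ (n + 1))

/-- A nondeterministic automaton is GFG if its nondeterminism can be resolved
based only on the prefix of the word read so far. -/
def NPA.GFG {A P : Type} (N : NPA A P) : Prop :=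
  ∃ f : List A → P, f [] = N.init ∧ (∀ u a, f (u ++ [a]) ∈ N.Δ (f u) a) ∧
    ∀ w : ℕ → A, N.Accepts w →
      ParityAcc fun n => N.prio (f (pref w n)) (w n) (f (pref w (n + 1)))

/-- Universal parity automaton. -/
structure UPA (A P : Type) where
  init : P
  Δ : P → A → Set P
  prio : P → A → P → ℕ

def UPA.IsRun {A P : Type} (N : UPA A P) (w : ℕ → A) (ρ : ℕ → P) : Prop :=
  ρ 0 = N.init ∧ ∀ n, ρ (n + 1) ∈ N.Δ (ρ n) (w n)

def UPA.Accepts {A P : Type} (N : UPA A P) (w : ℕ → A) : Prop :=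
  ∀ ρ, N.IsRun w ρ → ParityAcc fun n => N.prio (ρ n) (w n) (ρ (n + 1))

/-- A universal automaton is GFG if its universality can be resolved online:
on every word outside the language the produced run is rejecting. -/
def UPA.GFG {A P : Type} (N : UPA A P) : Prop :=
  ∃ f : List A → P, f [] = N.init ∧ (∀ u a, f (u ++ [a]) ∈ N.Δ (f u) a) ∧
    ∀ w : ℕ → A, ¬ N.Accepts w →
      ¬ ParityAcc fun n => N.prio (f (pref w n)) (w n) (f (pref w (n + 1)))

/-- A run of the box automaton `A^□` over `w` is a sequence of boxes. -/
def BoxRun {A Q : Type} (M : APW A Q) (w : ℕ → A) (β : ℕ → Set (Q × A × Q)) : Prop :=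
  ∀ n, β n ∈ BoxesAt M.δ (w n)

/-- Acceptance of the box automaton `A^□` built on a deterministic automaton `B`
over boxes: some box run is accepted by `B`. -/
def boxAccepts {A Q P : Type} (M : APW A Q) (B : DPA (Set (Q × A × Q)) P)
    (w : ℕ → A) : Prop :=
  ∃ β, BoxRun M w β ∧ B.Accepts β

/-- GFGness of the box automaton `A^□`: the box (its only nondeterminism) can be
chosen based only on the prefix of the word read. -/
def boxGFG {A Q P : Type} (M : APW A Q) (B : DPA (Set (Q × A × Q)) P) : Prop :=
  ∃ g : List A → A → Set (Q × A × Q),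
    (∀ u a, g u a ∈ BoxesAt M.δ a) ∧
    ∀ w : ℕ → A, boxAccepts M B w → B.Accepts (fun n => g (pref w n) (w n))

/-- A Rabin/Streett pair of sets of transitions. -/
structure RabinPair (T : Type) where
  bad : Set T
  good : Set T

def RabinAcc {T : Type} (pairs : Set (RabinPair T)) (t : ℕ → T) : Prop :=
  ∃ p ∈ pairs, (¬ InfOften fun n => t n ∈ p.bad) ∧ InfOften fun n => t n ∈ p.good

def StreettAcc {T : Type} (pairs : Set (RabinPair T)) (t : ℕ → T) : Prop :=
  ∀ p ∈ pairs, (¬ InfOften fun n => t n ∈ p.bad) ∨ InfOften fun n => t n ∈ p.good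

/-- Alternating Rabin automaton. -/
structure ARW (A Q : Type) where
  init : Q
  δ : Q → A → PosBool Q
  pairs : Set (RabinPair (Q × A × Q))

def ARW.toAlt {A Q : Type} (M : ARW A Q) : AltAut A Q :=
  { init := M.init, δ := M.δ, acc := RabinAcc M.pairs }

/-- Alternating Streett automaton. -/
structure ASW (A Q : Type) where
  init : Q
  δ : Q → A → PosBool Q
  pairs : Set (RabinPair (Q × A × Q))

def ASW.toAlt {A Q : Type} (M : ASW A Q) : AltAut A Q :=
  { init := M.init, δ := M.δ, acc := StreettAcc M.pairs }

end GFGPaper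

namespace GFGPaper

/-- The number whose binary expansion is `1` followed by the first `n` bits of `x`. -/
def binVal (x : ℕ → Bool) : ℕ → ℕ
  | 0 => 1
  | n + 1 => 2 * binVal x n + (x n).toNat

theorem binVal_congr {x y : ℕ → Bool} {n : ℕ} (h : ∀ i < n, x i = y i) :
    binVal x n = binVal y n := by
  induction n with
  | zero => rfl
  | succ n ih => simp only [binVal]; rw [ih fun i hi => h i (by omega), h n (by omega)]

theorem binVal_mul_le (x : ℕ → Bool) (n d : ℕ) : 2 ^ d * binVal x n ≤ binVal x (n + d) := by
  induction d with
  | zero => simp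
  | succ d ih => rw [← add_assoc, binVal, pow_succ]; linarith

theorem binVal_lt_mul (x : ℕ → Bool) (n d : ℕ) :
    binVal x (n + d) < 2 ^ d * (binVal x n + 1) := by
  induction d with
  | zero => simp
  | succ d ih =>
    rw [← add_assoc, binVal, pow_succ]
    have := Bool.toNat_le (x (n + d))
    nlinarith

theorem binVal_eq_of_false {x : ℕ → Bool} {n : ℕ} (h : ∀ i, n ≤ i → x i = false) (d : ℕ) :
    binVal x (n + d) = 2 ^ d * binVal x n := by
  induction d with
  | zero => simp
  | succ d ih => rw [← add_assoc, binVal, ih, h _ (by omega), pow_succ]; simp; ring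

theorem false_of_pow_dvd_binVal {x : ℕ → Bool} {N : ℕ} :
    ∀ d, 2 ^ d ∣ binVal x (N + d) → ∀ i, N ≤ i → i < N + d → x i = false := by
  intro d
  induction d with
  | zero => intro _ i h1 h2; omega
  | succ d ih =>
    intro h i h1 h2
    rw [← add_assoc, binVal, pow_succ] at h
    have hb : x (N + d) = false := by
      have h2 : 2 ∣ 2 * binVal x (N + d) + (x (N + d)).toNat := dvd_trans (dvd_mul_left _ _) h
      cases hx : x (N + d) with
      | false => rfl
      | true => rw [hx] at h2; simp only [Bool.toNat_true] at h2; omega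
    rcases Nat.lt_or_ge i (N + d) with hlt | hge
    · refine ih ?_ i h1 hlt
      rw [hb, mul_comm (2 ^ d) 2] at h
      exact Nat.dvd_of_mul_dvd_mul_left two_pos (by simpa only [Bool.toNat_false, add_zero] using h)
    · rwa [show i = N + d by omega]

/-- A sequence `b` is a cluster point of a sequence of sequences `x`. -/
def IsCluster {S : Type} (x : ℕ → ℕ → S) (b : ℕ → S) : Prop :=
  ∀ j n₀, ∃ n, n₀ ≤ n ∧ ∀ i < j, x n i = b i

theorem exists_isCluster {S : Type} [Finite S] (x : ℕ → ℕ → S) : ∃ b, IsCluster x b := by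
  let _ : TopologicalSpace S := ⊥
  have : DiscreteTopology S := ⟨rfl⟩
  obtain ⟨b, hb⟩ := exists_clusterPt_of_compactSpace (Filter.map x Filter.atTop)
  refine ⟨b, fun j n₀ => ?_⟩
  have hb : MapClusterPt b Filter.atTop x := hb
  have hopen : IsOpen {y : ℕ → S | ∀ i ∈ Finset.range j, y i = b i} := by
    have : {y : ℕ → S | ∀ i ∈ Finset.range j, y i = b i} =
        ⋂ i ∈ Finset.range j, (fun y : ℕ → S => y i) ⁻¹' {b i} := by
      ext y; simp
    rw [this]
    exact isOpen_biInter_finset fun i _ => (isOpen_discrete _).preimage (continuous_apply i)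
  have := (hb.frequently (hopen.mem_nhds (by simp))).forall_exists_of_atTop n₀
  obtain ⟨n, hn, h⟩ := this
  exact ⟨n, hn, fun i hi => h i (by simpa using hi)⟩

theorem IsCluster.comp {S T : Type} {x : ℕ → ℕ → S} {b : ℕ → S} (h : IsCluster x b)
    (f : ℕ → S → S → T) :
    IsCluster (fun n i => f i (x n i) (x n (i + 1))) (fun i => f i (b i) (b (i + 1))) := by
  intro j n₀
  obtain ⟨n, hn, hx⟩ := h (j + 1) n₀
  exact ⟨n, hn, fun i hi => by simp only [hx i (by omega), hx (i + 1) (by omega)]⟩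

/-- If the values of the prefixes grow at least by doubling, and infinitely often by more,
every cluster point has infinitely many ones. -/
theorem infOften_of_isCluster {x : ℕ → ℕ → Bool} {b : ℕ → Bool} {N : ℕ}
    (hdbl : ∀ n, N ≤ n → 2 * binVal (x n) n ≤ binVal (x (n + 1)) (n + 1))
    (hinf : InfOften fun n => 2 * binVal (x n) n < binVal (x (n + 1)) (n + 1))
    (hb : IsCluster x b) : InfOften fun n => b n = true := by
  by_contra hcon
  unfold InfOften at hcon
  push Not at hcon
  obtain ⟨J₀, hJ₀⟩ := hcon
  obtain ⟨J, hJN, hJ⟩ : ∃ J, N ≤ J ∧ ∀ j, J ≤ j → b j = false :=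
    ⟨max N J₀, le_max_left _ _, fun j hj => by
      simpa using hJ₀ j (le_trans (le_max_right _ _) hj)⟩
  have hmono : ∀ n, N ≤ n → ∀ d, 2 ^ d * binVal (x n) n ≤ binVal (x (n + d)) (n + d) := by
    intro n hn d
    induction d with
    | zero => simp
    | succ d ih =>
      have := hdbl (n + d) (by omega)
      rw [← add_assoc, pow_succ]; linarith
  have hle : ∀ n, N ≤ n → binVal (x n) n ≤ binVal b n := by
    intro n hn
    obtain ⟨n', hn', hag⟩ := hb n n
    obtain ⟨d, rfl⟩ := Nat.exists_eq_add_of_le hn'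
    have h1 := hmono n hn d
    have h2 := binVal_lt_mul (x (n + d)) n d
    rw [binVal_congr hag] at h2
    have h3 := lt_of_le_of_lt h1 h2
    have := Nat.lt_of_mul_lt_mul_left h3
    omega
  obtain ⟨n₁, hn₁, hag⟩ := hb J J
  have heq : ∀ n, n₁ ≤ n → binVal (x n) n = binVal b n := by
    intro n hn
    refine le_antisymm (hle n (by omega)) ?_
    obtain ⟨d, rfl⟩ := Nat.exists_eq_add_of_le hn
    obtain ⟨c, rfl⟩ := Nat.exists_eq_add_of_le hn₁
    rw [add_assoc, binVal_eq_of_false hJ, pow_add, mul_comm (2 ^ c), mul_assoc]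
    rw [← add_assoc]
    refine le_trans (Nat.mul_le_mul_left _ ?_) (hmono (J + c) (by omega) d)
    rw [← binVal_congr hag]
    exact binVal_mul_le _ _ _
  obtain ⟨n, hn, hlt⟩ := hinf n₁
  simp only [heq n hn, heq (n + 1) (by omega)] at hlt
  rw [binVal, hJ n (by omega)] at hlt
  simp at hlt

theorem not_infOften_iff {P : ℕ → Prop} : ¬ InfOften P ↔ ∃ N, ∀ n, N ≤ n → ¬ P n := by
  unfold InfOften; push Not; rfl

theorem InfOften.mono {P R : ℕ → Prop} (h : InfOften P) (N : ℕ) (hPR : ∀ n, N ≤ n → P n → R n) :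
    InfOften R := by
  intro n₀
  obtain ⟨n, hn, hp⟩ := h (max N n₀)
  exact ⟨n, le_trans (le_max_right _ _) hn, hPR n (le_trans (le_max_left _ _) hn) hp⟩

/-- An eventually bounded sequence has a largest value taken infinitely often. -/
theorem exists_max_infOften {c : ℕ → ℕ} {K N : ℕ} (hc : ∀ n, N ≤ n → c n < K) :
    ∃ p, InfOften (fun n => c n = p) ∧ ∃ N, ∀ n, N ≤ n → c n ≤ p := by
  induction K generalizing N with
  | zero => exact absurd (hc N le_rfl) (by omega)
  | succ K ih =>
    by_cases h : InfOften fun n => c n = K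
    · exact ⟨K, h, N, fun n hn => Nat.lt_succ_iff.mp (hc n hn)⟩
    · obtain ⟨N', hN'⟩ := not_infOften_iff.mp h
      refine ih (N := max N N') fun n hn => ?_
      have h1 := hc n (le_trans (le_max_left _ _) hn)
      have h2 := hN' n (le_trans (le_max_right _ _) hn)
      omega

theorem not_parityAcc_of_odd {c : ℕ → ℕ} {p : ℕ} (hp : Odd p)
    (hinf : InfOften fun n => c n = p) (hfin : ∀ q, p < q → ¬ InfOften fun n => c n = q) :
    ¬ ParityAcc c := by
  rintro ⟨r, hr, hri, hrm⟩
  rcases lt_trichotomy p r with h | h | h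
  · exact hfin r h hri
  · subst h; exact (Nat.not_even_iff_odd.mpr hp) hr
  · exact hrm p h hinf

theorem not_infOften_of_le {c : ℕ → ℕ} {p N : ℕ} (h : ∀ n, N ≤ n → c n ≤ p) {q : ℕ} (hq : p < q) :
    ¬ InfOften fun n => c n = q :=
  not_infOften_iff.mpr ⟨N, fun n hn hcq => by have := h n hn; omega⟩

/-- Update of the score of a finite priority word for priority `ℓ`, when `c` is appended:
the time since the last `ℓ` if `ℓ` is even, the positions of all `ℓ`s (in binary) if it is odd. -/
def keyStep (ℓ v c : ℕ) : ℕ :=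
  if Even ℓ then (if c = ℓ then 0 else v + 1) else 2 * v + (decide (c = ℓ)).toNat

/-- The score for priority `ℓ` of the first `n` letters of `x`; large scores are good for Adam. -/
def histKey (ℓ : ℕ) (x : ℕ → ℕ) : ℕ → ℕ
  | 0 => 1
  | n + 1 => keyStep ℓ (histKey ℓ x n) (x n)

theorem histKey_congr {ℓ : ℕ} {x y : ℕ → ℕ} {n : ℕ} (h : ∀ i < n, x i = y i) :
    histKey ℓ x n = histKey ℓ y n := by
  induction n with
  | zero => rfl
  | succ n ih => simp only [histKey]; rw [ih fun i hi => h i (by omega), h n (by omega)]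

theorem histKey_eq_binVal {ℓ : ℕ} (hℓ : ¬ Even ℓ) (x : ℕ → ℕ) (n : ℕ) :
    histKey ℓ x n = binVal (fun i => decide (x i = ℓ)) n := by
  induction n with
  | zero => rfl
  | succ n ih => simp [histKey, binVal, keyStep, hℓ, ih]

theorem histKey_le {ℓ : ℕ} (hℓ : Even ℓ) (x : ℕ → ℕ) (n : ℕ) : histKey ℓ x n ≤ n + 1 := by
  induction n with
  | zero => simp [histKey]
  | succ n ih => simp only [histKey, keyStep, hℓ, if_true]; split_ifs <;> omega

theorem histKey_add_lt {ℓ : ℕ} (hℓ : Even ℓ) {x : ℕ → ℕ} {i : ℕ} (hi : x i = ℓ) (d : ℕ) :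
    histKey ℓ x (i + 1 + d) ≤ d := by
  induction d with
  | zero => simp [histKey, keyStep, hℓ, hi]
  | succ d ih =>
    rw [← add_assoc]; simp only [histKey, keyStep, hℓ, if_true]; split_ifs <;> omega

/-- The scores for `ℓ` eventually evolve as if no `ℓ` occurred. -/
def ScoreFrozen (c : ℕ → ℕ) (x : ℕ → ℕ → ℕ) (ℓ : ℕ) : Prop :=
  ∃ N, ∀ n, N ≤ n → c n ≠ ℓ ∧
    histKey ℓ (x (n + 1)) (n + 1) = keyStep ℓ (histKey ℓ (x n) n) (c n)

theorem ScoreFrozen.not_infOften {c b : ℕ → ℕ} {x : ℕ → ℕ → ℕ} {ℓ : ℕ}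
    (h : ScoreFrozen c x ℓ) (hb : IsCluster x b) : ¬ InfOften fun n => b n = ℓ := by
  obtain ⟨N, hN⟩ := h
  refine not_infOften_iff.mpr ⟨N, fun i hi hbi => ?_⟩
  obtain ⟨n, hn, hag⟩ := hb (i + 1) (max N (i + 1))
  have hn1 : N ≤ n := le_trans (le_max_left _ _) hn
  have hn2 : i + 1 ≤ n := le_trans (le_max_right _ _) hn
  have hxi : x n i = ℓ := by rw [hag i (by omega), hbi]
  obtain ⟨d, rfl⟩ := Nat.exists_eq_add_of_le hn1
  by_cases hℓ : Even ℓ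
  · have key : ∀ d, d ≤ histKey ℓ (x (N + d)) (N + d) := by
      intro d
      induction d with
      | zero => simp
      | succ d ih =>
        obtain ⟨h1, h2⟩ := hN (N + d) (by omega)
        rw [← add_assoc, h2]
        simp only [keyStep, hℓ, if_true, h1, if_false]; omega
    obtain ⟨f, hf⟩ := Nat.exists_eq_add_of_le hn2
    have h1 := histKey_add_lt hℓ hxi f
    have h2 := key d
    rw [← hf] at h1
    omega
  · have key : ∀ d, 2 ^ d ∣ histKey ℓ (x (N + d)) (N + d) := by
      intro d
      induction d with
      | zero => simp
      | succ d ih =>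
        obtain ⟨h1, h2⟩ := hN (N + d) (by omega)
        rw [← add_assoc, h2]
        simp only [keyStep, hℓ, if_false, h1, decide_false, Bool.toNat_false, add_zero]
        rw [pow_succ, mul_comm]
        exact Nat.mul_dvd_mul_left 2 ih
    have h1 := key d
    rw [histKey_eq_binVal hℓ] at h1
    have := false_of_pow_dvd_binVal d h1 i hi (by omega)
    simp [hxi] at this

theorem eventually_const_of_antitone {f : ℕ → ℕ} {N : ℕ} (h : ∀ n, N ≤ n → f (n + 1) ≤ f n) :
    ∃ N', N ≤ N' ∧ ∀ n, N' ≤ n → f n = f N' := by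
  have hne : (f '' {n | N ≤ n}).Nonempty := ⟨f N, N, le_refl N, rfl⟩
  obtain ⟨N', hN', hmin⟩ := Nat.sInf_mem hne
  refine ⟨N', hN', fun n hn => ?_⟩
  induction n, hn using Nat.le_induction with
  | base => rfl
  | succ n hn ih =>
    have hNn : N ≤ n := le_trans hN' hn
    refine le_antisymm (ih ▸ h n hNn) ?_
    rw [hmin]
    exact Nat.sInf_le ⟨n + 1, Nat.le_succ_of_le hNn, rfl⟩

theorem scoreFrozen_of_even {c : ℕ → ℕ} {x : ℕ → ℕ → ℕ} {ℓ N : ℕ} (hℓ : Even ℓ)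
    (hc : ∀ n, N ≤ n → c n ≠ ℓ)
    (hle : ∀ n, N ≤ n → keyStep ℓ (histKey ℓ (x n) n) (c n) ≤ histKey ℓ (x (n + 1)) (n + 1)) :
    ScoreFrozen c x ℓ := by
  have hstep : ∀ n, N ≤ n → histKey ℓ (x n) n + 1 ≤ histKey ℓ (x (n + 1)) (n + 1) := by
    intro n hn
    have := hle n hn
    simpa only [keyStep, hℓ, if_true, hc n hn, if_false] using this
  obtain ⟨N', hN', hconst⟩ := eventually_const_of_antitone
    (f := fun n => n + 1 - histKey ℓ (x n) n) (N := N) fun n hn => by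
      have := hstep n hn
      omega
  refine ⟨N', fun n hn => ⟨hc n (by omega), ?_⟩⟩
  simp only [keyStep, hℓ, if_true, hc n (by omega), if_false]
  have h1 := hconst n hn
  have h2 := hconst (n + 1) (by omega)
  have h3 := histKey_le hℓ (x n) n
  have h4 := histKey_le hℓ (x (n + 1)) (n + 1)
  omega

/-- If an odd priority sequence `c` is dominated by words `x n` whose scores grow, in the
lexicographic order that considers large priorities first, at least as when appending `c n`,
then every cluster point of the words is odd as well. -/
theorem not_parityAcc_of_isCluster {k : ℕ} {c b : ℕ → ℕ} {x : ℕ → ℕ → ℕ}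
    (hck : ∀ n, c n < k) (hbk : ∀ n, b n < k) (hc : ¬ ParityAcc c)
    (hkey : ∀ n ℓ, ℓ < k → (∀ ℓ', ℓ < ℓ' → ℓ' < k →
      histKey ℓ' (x (n + 1)) (n + 1) = keyStep ℓ' (histKey ℓ' (x n) n) (c n)) →
      keyStep ℓ (histKey ℓ (x n) n) (c n) ≤ histKey ℓ (x (n + 1)) (n + 1))
    (hb : IsCluster x b) : ¬ ParityAcc b := by
  obtain ⟨p, hp, N, hN⟩ := exists_max_infOften (N := 0) fun n _ => hck n
  have hpk : p < k := by obtain ⟨n, -, h⟩ := hp 0; exact h ▸ hck n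
  have hodd : ¬ Even p := fun he => hc ⟨p, he, hp, fun q hq => not_infOften_of_le hN hq⟩
  -- priorities above `ℓ` are frozen, so the scores for `ℓ` are monotone
  have hmono : ∀ ℓ, ℓ < k → (∀ ℓ', ℓ < ℓ' → ℓ' < k → ScoreFrozen c x ℓ') →
      ∃ N, ∀ n, N ≤ n →
        keyStep ℓ (histKey ℓ (x n) n) (c n) ≤ histKey ℓ (x (n + 1)) (n + 1) := by
    intro ℓ hℓ hfr
    choose! F hF using hfr
    refine ⟨(Finset.range k).sup F, fun n hn => hkey n ℓ hℓ fun ℓ' h1 h2 => ?_⟩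
    exact (hF ℓ' h1 h2 n (le_trans (Finset.le_sup (Finset.mem_range.mpr h2)) hn)).2
  have hend : ∀ ℓ, ℓ < k → Odd ℓ → (∀ ℓ', ℓ < ℓ' → ℓ' < k → ScoreFrozen c x ℓ') →
      InfOften (fun n => 2 * histKey ℓ (x n) n < histKey ℓ (x (n + 1)) (n + 1)) →
      ¬ ParityAcc b := by
    intro ℓ hℓ ho hfr hinf
    have hne := Nat.not_even_iff_odd.mpr ho
    obtain ⟨N', hN'⟩ := hmono ℓ hℓ hfr
    have hi : InfOften fun n => decide (b n = ℓ) = true := by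
      refine infOften_of_isCluster (x := fun n i => decide (x n i = ℓ)) (N := N') ?_ ?_ ?_
      · intro n hn
        rw [← histKey_eq_binVal hne, ← histKey_eq_binVal hne]
        have := hN' n hn
        rw [keyStep, if_neg hne] at this
        omega
      · refine hinf.mono 0 fun n _ h => ?_
        rwa [← histKey_eq_binVal hne, ← histKey_eq_binVal hne]
      · intro j n₀
        obtain ⟨n, hn, hag⟩ := hb j n₀
        exact ⟨n, hn, fun i hi => by simp only [hag i hi]⟩
    refine not_parityAcc_of_odd ho (hi.mono 0 fun n _ h => by simpa using h) fun q hq => ?_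
    by_cases hqk : q < k
    · exact (hfr q hq hqk).not_infOften hb
    · exact not_infOften_iff.mpr ⟨0, fun n _ h => hqk (h ▸ hbk n)⟩
  by_contra hcon
  have hfrozen : ∀ d, ∀ ℓ, p < ℓ → ℓ < k → k ≤ ℓ + d → ScoreFrozen c x ℓ := by
    intro d
    induction d with
    | zero => intro ℓ _ h1 h2; omega
    | succ d ih =>
      intro ℓ hpℓ hℓk hd
      have hfr : ∀ ℓ', ℓ < ℓ' → ℓ' < k → ScoreFrozen c x ℓ' := fun ℓ' h1 h2 =>
        ih ℓ' (by omega) h2 (by omega)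
      obtain ⟨N', hN'⟩ := hmono ℓ hℓk hfr
      have hcℓ : ∀ n, max N N' ≤ n → c n ≠ ℓ := fun n hn h => by
        have := hN n (le_trans (le_max_left _ _) hn); omega
      by_cases he : Even ℓ
      · exact scoreFrozen_of_even he hcℓ fun n hn => hN' n (le_trans (le_max_right _ _) hn)
      · have hni := mt (hend ℓ hℓk (Nat.not_even_iff_odd.mp he) hfr) (not_not.mpr hcon)
        obtain ⟨N'', hN''⟩ := not_infOften_iff.mp hni
        refine ⟨max (max N N') N'', fun n hn => ?_⟩
        have h1 := hcℓ n (le_trans (le_max_left _ _) hn)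
        have h2 := hN' n (le_trans (le_trans (le_max_right _ _) (le_max_left _ _)) hn)
        have h3 := hN'' n (le_trans (le_max_right _ _) hn)
        refine ⟨h1, ?_⟩
        simp only [keyStep, he, if_false, h1, decide_false, Bool.toNat_false, add_zero] at h2 ⊢
        omega
  have hfr : ∀ ℓ', p < ℓ' → ℓ' < k → ScoreFrozen c x ℓ' := fun ℓ' h1 h2 =>
    hfrozen k ℓ' h1 h2 (by omega)
  refine hend p hpk (Nat.not_even_iff_odd.mp hodd) hfr ?_ hcon
  obtain ⟨N', hN'⟩ := hmono p hpk hfr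
  refine hp.mono N' fun n hn h => ?_
  have := hN' n hn
  simp only [keyStep, hodd, if_false, h, decide_true, Bool.toNat_true] at this
  omega

theorem length_pref {A : Type} (w : ℕ → A) (n : ℕ) : (pref w n).length = n := by simp [pref]

theorem pref_succ {A : Type} (w : ℕ → A) (n : ℕ) : pref w (n + 1) = pref w n ++ [w n] := by
  simp only [pref, List.ofFn_succ', List.concat_eq_append]
  rfl

/-- Every nonempty finite set of finite priority words contains one with lexicographically maximal
scores, where larger priorities take precedence. -/
theorem exists_lexMax {T : Type} (k : ℕ) (f : ℕ → T → ℕ) {s : Set T} (hs : s.Finite)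
    (hne : s.Nonempty) :
    ∃ y ∈ s, ∀ z ∈ s, ∀ ℓ, ℓ < k → (∀ ℓ', ℓ < ℓ' → ℓ' < k → f ℓ' y = f ℓ' z) → f ℓ z ≤ f ℓ y := by
  let key : T → Lex ((Fin k)ᵒᵈ → ℕ) := fun y => toLex fun r => f (OrderDual.ofDual r).val y
  obtain ⟨y, hy, hmax⟩ := Set.exists_max_image s key hs hne
  refine ⟨y, hy, fun z hz ℓ hℓ heq => ?_⟩
  by_contra hlt
  refine absurd (hmax z hz) (not_le.mpr ?_)
  refine ⟨OrderDual.toDual ⟨ℓ, hℓ⟩, fun j hj => ?_, not_le.mp hlt⟩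
  exact heq _ hj (OrderDual.ofDual j).isLt

section Positional

variable {A Q : Type} (M : APW A Q) (k : ℕ) (hk : ∀ q a q', M.prio q a q' < k)
  (σ : List (A × Q) → (a : A) → (q : Q) → EveChoice (M.δ q a))

/-- The history of the letter game in which Adam plays `u` and the states are listed by `y`. -/
def playHist (u : List A) (y : ℕ → Q × Fin k) : List (A × Q) :=
  u.mapIdx fun i a => (a, (y i).1)

theorem playHist_pref (w : ℕ → A) (n : ℕ) (y : ℕ → Q × Fin k) :
    playHist k (pref w n) y = List.ofFn fun i : Fin n => (w i.val, (y i).1) := by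
  apply List.ext_getElem
  · simp [playHist, pref]
  · intro i h1 h2
    simp [playHist, pref]

/-- The one-letter extensions ending in `q'` of the representative plays `R`. -/
def extensions (u : List A) (R : Q → Option (ℕ → Q × Fin k)) (a : A) (q' : Q) :
    Set (ℕ → Q × Fin k) :=
  { z | ∃ q y, R q = some y ∧ q' ∈ (σ (playHist k u y) a q).outcome ∧
    z = Function.update y u.length (q', ⟨M.prio q a q', hk q a q'⟩) }

theorem extensions_finite [Finite Q] (u : List A) (R : Q → Option (ℕ → Q × Fin k)) (a : A)
    (q' : Q) : (extensions M k hk σ u R a q').Finite := by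
  refine (Set.finite_range fun q : Q => Function.update ((R q).getD fun _ =>
    (q', ⟨M.prio q a q', hk q a q'⟩)) u.length (q', ⟨M.prio q a q', hk q a q'⟩)).subset ?_
  rintro z ⟨q, y, hy, -, rfl⟩
  exact ⟨q, by simp [hy]⟩

/-- `y` has maximal scores among the plays of length `n` in `s`. -/
def IsBest (s : Set (ℕ → Q × Fin k)) (n : ℕ) (y : ℕ → Q × Fin k) : Prop :=
  y ∈ s ∧ ∀ z ∈ s, ∀ ℓ, ℓ < k →
    (∀ ℓ', ℓ < ℓ' → ℓ' < k →
      histKey ℓ' (fun i => (y i).2) n = histKey ℓ' (fun i => (z i).2) n) →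
    histKey ℓ (fun i => (z i).2) n ≤ histKey ℓ (fun i => (y i).2) n

open Classical in
/-- The representative play of every state after one more letter. -/
noncomputable def repStep (u : List A) (R : Q → Option (ℕ → Q × Fin k)) (a : A) (q' : Q) :
    Option (ℕ → Q × Fin k) :=
  if h : ∃ y, IsBest k (extensions M k hk σ u R a q') (u.length + 1) y then some h.choose else none

theorem isBest_of_repStep {u : List A} {R : Q → Option (ℕ → Q × Fin k)} {a : A} {q' : Q}
    {y : ℕ → Q × Fin k} (h : repStep M k hk σ u R a q' = some y) :
    IsBest k (extensions M k hk σ u R a q') (u.length + 1) y := by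
  unfold repStep at h
  split_ifs at h with hex
  rw [← Option.some.inj h]
  exact hex.choose_spec

theorem exists_repStep [Finite Q] {u : List A} {R : Q → Option (ℕ → Q × Fin k)} {a : A} {q' : Q}
    (h : (extensions M k hk σ u R a q').Nonempty) : ∃ y, repStep M k hk σ u R a q' = some y := by
  have : ∃ y, IsBest k (extensions M k hk σ u R a q') (u.length + 1) y :=
    exists_lexMax k (fun ℓ (y : ℕ → Q × Fin k) => histKey ℓ (fun i => (y i).2) (u.length + 1))
      (extensions_finite M k hk σ u R a q') h
  exact ⟨_, dif_pos this⟩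

open Classical in
/-- Representative plays after the reverse of the given word. -/
noncomputable def repRev (d : Fin k) : List A → Q → Option (ℕ → Q × Fin k)
  | [] => fun q => if q = M.init then some fun _ => (M.init, d) else none
  | a :: u => repStep M k hk σ u.reverse (repRev d u) a

/-- Representative plays after a word. -/
noncomputable def rep (d : Fin k) (u : List A) : Q → Option (ℕ → Q × Fin k) :=
  repRev M k hk σ d u.reverse

theorem rep_append (d : Fin k) (u : List A) (a : A) :
    rep M k hk σ d (u ++ [a]) = repStep M k hk σ u (rep M k hk σ d u) a := by
  simp [rep, repRev]

/-- The states visited by a play. -/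
def states (q₀ : Q) (y : ℕ → Q × Fin k) : ℕ → Q
  | 0 => q₀
  | n + 1 => (y n).1

theorem states_congr {q₀ : Q} {y z : ℕ → Q × Fin k} {n : ℕ} (h : ∀ i < n, y i = z i) :
    states k q₀ y n = states k q₀ z n := by
  cases n with
  | zero => rfl
  | succ n => simp only [states, h n (by omega)]

/-- `y` is a legal `i`-th move of Eve's strategy `σ` on the word `w`. -/
def LegalAt (w : ℕ → A) (y : ℕ → Q × Fin k) (i : ℕ) : Prop :=
  (y i).1 ∈ (σ (playHist k (pref w i) y) (w i) (states k M.init y i)).outcome ∧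
    ((y i).2 : ℕ) = M.prio (states k M.init y i) (w i) (y i).1

theorem LegalAt.congr {w : ℕ → A} {y z : ℕ → Q × Fin k} {i : ℕ} (h : ∀ j < i + 1, y j = z j)
    (hy : LegalAt M k σ w y i) : LegalAt M k σ w z i := by
  unfold LegalAt at hy ⊢
  rw [playHist_pref] at hy ⊢
  have h1 : (List.ofFn fun j : Fin i => (w j.val, (y j).1)) =
      List.ofFn fun j : Fin i => (w j.val, (z j).1) := by
    congr 1
    funext j
    rw [h j (by omega)]
  rwa [h1, states_congr k (q₀ := M.init) fun j hj => h j (by omega), h i (by omega)] at hy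

theorem rep_legal (d : Fin k) (w : ℕ → A) (n : ℕ) : ∀ q y, rep M k hk σ d (pref w n) q = some y →
    states k M.init y n = q ∧ ∀ i < n, LegalAt M k σ w y i := by
  induction n with
  | zero =>
    intro q y h
    simp only [rep, pref, List.ofFn_zero, List.reverse_nil, repRev] at h
    split_ifs at h with hq
    exact ⟨hq.symm, fun i hi => by omega⟩
  | succ n ih =>
    intro q' z h
    rw [pref_succ, rep_append] at h
    obtain ⟨⟨q, y, hy, hq', rfl⟩, -⟩ := isBest_of_repStep M k hk σ h
    obtain ⟨h1, h2⟩ := ih q y hy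
    rw [length_pref]
    have hag : ∀ j < n, y j = Function.update y n (q', ⟨M.prio q (w n) q', hk q (w n) q'⟩) j :=
      fun j hj => by rw [Function.update_of_ne hj.ne]
    refine ⟨by simp [states], fun i hi => ?_⟩
    rcases Nat.lt_succ_iff_lt_or_eq.mp hi with hin | rfl
    · exact (h2 i hin).congr M k σ fun j hj => hag j (by omega)
    · unfold LegalAt
      rw [← states_congr k hag, h1, Function.update_self, playHist_pref]
      rw [playHist_pref] at hq'
      have h3 : (List.ofFn fun j : Fin i => (w j.val,
          (Function.update y i (q', ⟨M.prio q (w i) q', hk q (w i) q'⟩) j).1)) =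
          List.ofFn fun j : Fin i => (w j.val, (y j).1) := by
        congr 1
        funext j
        rw [← hag j j.2]
      rw [h3]
      exact ⟨hq', rfl⟩

end Positional

/-- If Eve wins the letter game of an alternating parity automaton, she does so with a strategy
that only depends on the word read so far and on the current state. -/
theorem eveWinsPositional_of_existsGFG {A Q : Type} [Finite Q] (M : APW A Q) {k : ℕ}
    (hk : ∀ q a q', M.prio q a q' < k) (hM : ExistsGFG M.toAlt) :
    EveWinsPositional M.toAlt := by
  classical
  rcases isEmpty_or_nonempty A with hA | ⟨⟨a₀⟩⟩
  · exact ⟨fun _ a => (hA.false a).elim, fun w => (hA.false (w 0)).elim⟩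
  obtain ⟨σ, hσ⟩ : ∃ σ : List (A × Q) → (a : A) → (q : Q) → EveChoice (M.δ q a),
      ∀ (w : ℕ → A) (ρ : ℕ → Q), ρ 0 = M.init →
        (∀ n, ρ (n + 1) ∈
          (σ (List.ofFn fun i : Fin n => (w i.val, ρ (i.val + 1))) (w n) (ρ n)).outcome) →
        M.toAlt.Accepts w → M.toAlt.acc (trace w ρ) := hM
  let d : Fin k := ⟨M.prio M.init a₀ M.init, hk _ _ _⟩
  let τ : List A → (a : A) → (q : Q) → EveChoice (M.δ q a) := fun u a q =>
    match rep M k hk σ d u q with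
    | some y => σ (playHist k u y) a q
    | none => σ [] a q
  refine ⟨τ, fun w ρ hρ0 hρ hw => ?_⟩
  have hτ : ∀ n y, rep M k hk σ d (pref w n) (ρ n) = some y →
      ρ (n + 1) ∈ (σ (playHist k (pref w n) y) (w n) (ρ n)).outcome := by
    intro n y hy
    have h := hρ n
    change ρ (n + 1) ∈ (τ (pref w n) (w n) (ρ n)).outcome at h
    simp only [τ, hy] at h
    exact h
  have hex : ∀ n, ∃ y, rep M k hk σ d (pref w n) (ρ n) = some y := by
    intro n
    induction n with
    | zero =>
      have : ρ 0 = M.init := hρ0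
      simp [rep, pref, repRev, this]
    | succ n ih =>
      obtain ⟨y, hy⟩ := ih
      rw [pref_succ, rep_append]
      exact exists_repStep M k hk σ ⟨_, ρ n, y, hy, hτ n y hy, rfl⟩
  choose Y hY using hex
  obtain ⟨b, hb⟩ := exists_isCluster Y
  have hbl : ∀ i, LegalAt M k σ w b i := by
    intro i
    obtain ⟨n, hn, hag⟩ := hb (i + 1) (i + 1)
    exact ((rep_legal M k hk σ d w n _ _ (hY n)).2 i (by omega)).congr M k σ hag
  have hacc : M.toAlt.acc (trace w (states k M.init b)) := by
    refine hσ w (states k M.init b) rfl (fun n => ?_) hw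
    have := (hbl n).1
    rw [playHist_pref] at this
    exact this
  by_contra hrej
  refine not_parityAcc_of_isCluster (k := k) (c := fun n => M.prio (ρ n) (w n) (ρ (n + 1)))
    (b := fun i => (b i).2) (x := fun n i => (Y n i).2) (fun n => hk _ _ _) (fun n => (b n).2.2)
    hrej ?_ ?_ ?_
  · intro n ℓ hℓ heq
    have hbest := hY (n + 1)
    rw [pref_succ, rep_append] at hbest
    have hb2 := (isBest_of_repStep M k hk σ hbest).2 _
      ⟨ρ n, Y n, hY n, hτ n _ (hY n), rfl⟩ ℓ hℓ
    rw [length_pref] at hb2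
    have hkey : ∀ ℓ', histKey ℓ' (fun i => ((Function.update (Y n) n (ρ (n + 1),
        ⟨M.prio (ρ n) (w n) (ρ (n + 1)), hk _ _ _⟩) i).2 : ℕ)) (n + 1) =
        keyStep ℓ' (histKey ℓ' (fun i => (Y n i).2) n) (M.prio (ρ n) (w n) (ρ (n + 1))) := by
      intro ℓ'
      simp only [histKey, Function.update_self]
      congr 1
      exact histKey_congr fun i hi => by rw [Function.update_of_ne hi.ne]
    simp only [hkey] at hb2
    exact hb2 heq
  · intro j n₀
    obtain ⟨n, hn, hag⟩ := hb j n₀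
    exact ⟨n, hn, fun i hi => by simp only [hag i hi]⟩
  · have hcol : (fun i => ((b i).2 : ℕ)) =
        fun n => M.prio (states k M.init b n) (w n) (states k M.init b (n + 1)) :=
      funext fun n => (hbl n).2
    rw [hcol]
    exact hacc

/-- Appending an edge, marked or not, to a path whose marks are the binary digits of `a`
(`0` stands for no path). -/
def extVal (a : ℕ) : Option Bool → ℕ
  | none => 0
  | some b => if a = 0 then 0 else 2 * a + b.toNat

theorem extVal_ne_zero {a : ℕ} {o : Option Bool} (h : extVal a o ≠ 0) :
    a ≠ 0 ∧ ∃ b, o = some b ∧ extVal a o = 2 * a + b.toNat := by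
  cases o with
  | none => exact absurd rfl h
  | some b =>
    have ha : a ≠ 0 := fun ha => h (by simp [extVal, ha])
    exact ⟨ha, b, rfl, by simp [extVal, ha]⟩

theorem extVal_some {a : ℕ} (ha : a ≠ 0) (b : Bool) : extVal a (some b) = 2 * a + b.toNat := by
  simp [extVal, ha]

section Profile

variable {S : Type} [Fintype S]

/-- The update of a profile, i.e. of the greatest values of paths ending in each state. -/
def pstep (e : S → S → Option Bool) (p : S → ℕ) (y : S) : ℕ :=
  Finset.univ.sup fun x => extVal (p x) (e x y)

theorem le_pstep (e : S → S → Option Bool) (p : S → ℕ) (x y : S) :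
    extVal (p x) (e x y) ≤ pstep e p y :=
  Finset.le_sup (f := fun x => extVal (p x) (e x y)) (Finset.mem_univ x)

theorem pstep_le {e : S → S → Option Bool} {p : S → ℕ} {y : S} {v : ℕ}
    (h : ∀ x, extVal (p x) (e x y) ≤ v) : pstep e p y ≤ v :=
  Finset.sup_le fun x _ => h x

theorem exists_pstep_eq {e : S → S → Option Bool} {p : S → ℕ} {y : S} (h : pstep e p y ≠ 0) :
    ∃ x b, e x y = some b ∧ p x ≠ 0 ∧ pstep e p y = 2 * p x + b.toNat := by
  obtain ⟨x, -, hx⟩ := Finset.exists_mem_eq_sup (Finset.univ : Finset S) (by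
    by_contra hne
    rw [Finset.not_nonempty_iff_eq_empty] at hne
    exact h (by simp [pstep, hne])) fun x => extVal (p x) (e x y)
  change pstep e p y = _ at hx
  obtain ⟨h1, b, h2, h3⟩ := extVal_ne_zero (hx ▸ h)
  exact ⟨x, b, h2, h1, hx.trans h3⟩

/-- The shape of the profiles after `n` steps; `z` is a state that is never reached. -/
def ValidProfile (z : S) (n : ℕ) (p : S → ℕ) : Prop :=
  p z = 0 ∧ ∀ s, p s = 0 ∨ 2 ^ n ≤ p s ∧ p s < 2 ^ (n + 1)

theorem ValidProfile.pstep {z : S} {n : ℕ} {p : S → ℕ} (h : ValidProfile z n p)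
    {e : S → S → Option Bool} (hz : ∀ x, e x z = none) :
    ValidProfile z (n + 1) (pstep e p) := by
  refine ⟨?_, fun y => ?_⟩
  · by_contra hne
    obtain ⟨x, b, hb, -⟩ := exists_pstep_eq hne
    simp [hz] at hb
  · by_cases hne : GFGPaper.pstep e p y = 0
    · exact Or.inl hne
    · obtain ⟨x, b, -, hx, heq⟩ := exists_pstep_eq hne
      have := (h.2 x).resolve_left hx
      have hb := Bool.toNat_le b
      rw [heq, pow_succ, pow_succ] at *
      right
      omega

/-- Profiles that order the states in the same way are updated in the same way. -/
theorem exists_parents {z : S} {p q : S → ℕ} (hpq : ∀ s t, p s ≤ p t ↔ q s ≤ q t)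
    (hp : p z = 0) (hq : q z = 0) (e : S → S → Option Bool) :
    ∃ (par : S → S) (bit : S → ℕ), ∀ y, bit y ≤ 1 ∧ (p (par y) = 0 → bit y = 0) ∧
      pstep e p y = 2 * p (par y) + bit y ∧ pstep e q y = 2 * q (par y) + bit y := by
  have hzero : ∀ s, p s = 0 ↔ q s = 0 := fun s => by
    have := hpq s z
    rw [hp, hq] at this
    simpa using this
  have hext : ∀ x y, extVal (p x) (e x y) = 0 ↔ extVal (q x) (e x y) = 0 := by
    intro x y
    have := hzero x
    cases e x y with
    | none => simp [extVal]
    | some b => simp only [extVal]; split_ifs <;> omega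
  have : ∀ y, ∃ (x : S) (b : ℕ), b ≤ 1 ∧ (p x = 0 → b = 0) ∧
      pstep e p y = 2 * p x + b ∧ pstep e q y = 2 * q x + b := by
    intro y
    by_cases h0 : pstep e p y = 0
    · refine ⟨z, 0, by omega, fun _ => rfl, by omega, ?_⟩
      rw [hq]
      refine Nat.le_zero.mp (pstep_le fun x => ?_)
      rw [(hext x y).mp (Nat.le_zero.mp (h0 ▸ le_pstep e p x y))]
    · obtain ⟨x, b, hb, hx, heq⟩ := exists_pstep_eq h0
      have hqx : q x ≠ 0 := fun h => hx ((hzero x).mpr h)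
      refine ⟨x, b.toNat, Bool.toNat_le b, fun h => absurd h hx, heq, le_antisymm ?_ ?_⟩
      · refine pstep_le fun t => ?_
        by_cases ht : extVal (q t) (e t y) = 0
        · omega
        · have htp := mt (hext t y).mp ht
          obtain ⟨hqt, c, hc, hqe⟩ := extVal_ne_zero ht
          obtain ⟨hpt, c', hc', hpe⟩ := extVal_ne_zero htp
          obtain rfl : c = c' := by rw [hc] at hc'; exact Option.some.inj hc'
          have h1 := le_pstep e p t y
          have h2 := Bool.toNat_le c
          have h3 := Bool.toNat_le b
          have h4 : p t ≤ p x := by omega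
          have h5 := (hpq t x).mp h4
          by_cases h6 : q x ≤ q t
          · have := (hpq x t).mpr h6
            omega
          · omega
      · have := le_pstep e q x y
        rwa [hb, extVal_some hqx] at this
  choose par bit h using this
  exact ⟨par, bit, h⟩

variable (s₀ : S) (e : ℕ → S → S → Option Bool)

open Classical in
/-- The profiles along a sequence of edge relations, for paths that start in `s₀`. -/
noncomputable def prof : ℕ → S → ℕ
  | 0 => fun s => if s = s₀ then 1 else 0
  | n + 1 => pstep (e n) (prof n)

theorem validProfile_prof {s₀ : S} {e : ℕ → S → S → Option Bool} {z : S} (hz : z ≠ s₀)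
    (he : ∀ n x, e n x z = none) (n : ℕ) : ValidProfile z n (prof s₀ e n) := by
  induction n with
  | zero =>
    refine ⟨by simp [prof, hz], fun s => ?_⟩
    by_cases h : s = s₀ <;> simp [prof, h]
  | succ n ih => exact ih.pstep (he n)

/-- An edge along which the greatest value is attained. -/
def TightEdge (i : ℕ) (x y : S) : Prop :=
  ∃ b, e i x y = some b ∧ prof s₀ e i x ≠ 0 ∧ prof s₀ e (i + 1) y = 2 * prof s₀ e i x + b.toNat

theorem exists_tight_history {n : ℕ} : ∀ {s : S}, prof s₀ e n s ≠ 0 →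
    ∃ h : ℕ → S, h 0 = s₀ ∧ h n = s ∧ ∀ i < n, TightEdge s₀ e i (h i) (h (i + 1)) := by
  induction n with
  | zero =>
    intro s hs
    have : s = s₀ := by
      by_contra hne
      exact hs (by simp [prof, hne])
    exact ⟨fun _ => s, this, rfl, fun i hi => absurd hi (Nat.not_lt_zero i)⟩
  | succ n ih =>
    intro s hs
    obtain ⟨x, b, h1, h2, h3⟩ := exists_pstep_eq (e := e n) (p := prof s₀ e n) hs
    obtain ⟨h, h0, hn, hh⟩ := ih h2
    refine ⟨fun i => if i ≤ n then h i else s, by simp [h0], by simp, fun i hi => ?_⟩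
    rcases Nat.lt_succ_iff_lt_or_eq.mp hi with hin | rfl
    · simpa [hin.le, Nat.succ_le_of_lt hin] using hh i hin
    · simp only [le_refl, if_true, Nat.not_succ_le_self, if_false, hn]
      exact ⟨b, h1, h2, h3⟩

theorem prof_eq_binVal {h : ℕ → S} {n : ℕ} (h0 : h 0 = s₀)
    (hh : ∀ i < n, TightEdge s₀ e i (h i) (h (i + 1))) :
    prof s₀ e n (h n) = binVal (fun i => decide (e i (h i) (h (i + 1)) = some true)) n := by
  induction n with
  | zero => simp [prof, binVal, h0]
  | succ n ih =>
    obtain ⟨b, h1, -, h3⟩ := hh n (by omega)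
    rw [h3, ih fun i hi => hh i (by omega)]
    simp only [binVal, h1]
    cases b <;> simp

/-- If there are states whose values dominate those of a growing path, infinitely often strictly,
then there is a path with infinitely many marks along which the greatest values are attained. -/
theorem exists_tight_path {s : ℕ → S} {N : ℕ} (hs : ∀ n, N ≤ n → prof s₀ e n (s n) ≠ 0)
    (hdbl : ∀ n, N ≤ n → 2 * prof s₀ e n (s n) ≤ prof s₀ e (n + 1) (s (n + 1)))
    (hinf : InfOften fun n => 2 * prof s₀ e n (s n) < prof s₀ e (n + 1) (s (n + 1))) :
    ∃ b : ℕ → S, b 0 = s₀ ∧ (∀ i, TightEdge s₀ e i (b i) (b (i + 1))) ∧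
      InfOften fun i => e i (b i) (b (i + 1)) = some true := by
  have hex : ∀ n, ∃ h : ℕ → S, N ≤ n →
      h 0 = s₀ ∧ h n = s n ∧ ∀ i < n, TightEdge s₀ e i (h i) (h (i + 1)) := by
    intro n
    by_cases hn : N ≤ n
    · obtain ⟨h, hh⟩ := exists_tight_history s₀ e (hs n hn)
      exact ⟨h, fun _ => hh⟩
    · exact ⟨fun _ => s₀, fun h => absurd h hn⟩
  choose x hx using hex
  obtain ⟨b, hb⟩ := exists_isCluster x
  have hval : ∀ n, N ≤ n → prof s₀ e n (s n) =
      binVal (fun i => decide (e i (x n i) (x n (i + 1)) = some true)) n := by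
    intro n hn
    obtain ⟨h0, h1, h2⟩ := hx n hn
    rw [← prof_eq_binVal s₀ e h0 h2, h1]
  refine ⟨b, ?_, fun i => ?_, ?_⟩
  · obtain ⟨n, hn, hag⟩ := hb 1 N
    rw [← hag 0 (by omega), (hx n hn).1]
  · obtain ⟨n, hn, hag⟩ := hb (i + 2) (N + i + 1)
    rw [← hag i (by omega), ← hag (i + 1) (by omega)]
    exact (hx n (by omega)).2.2 i (by omega)
  · have := infOften_of_isCluster (N := N)
      (x := fun n i => decide (e i (x n i) (x n (i + 1)) = some true))
      (b := fun i => decide (e i (b i) (b (i + 1)) = some true)) ?_ ?_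
      (hb.comp fun i y y' => decide (e i y y' = some true))
    · exact this.mono 0 fun n _ h => by simpa using h
    · intro n hn
      rw [← hval n hn, ← hval (n + 1) (by omega)]
      exact hdbl n hn
    · refine hinf.mono N fun n hn h => ?_
      rwa [← hval n hn, ← hval (n + 1) (by omega)]

theorem prof_path {b : ℕ → S} (h0 : b 0 = s₀) {m : ℕ → Bool}
    (hb : ∀ i, e i (b i) (b (i + 1)) = some (m i)) (n : ℕ) : prof s₀ e n (b n) ≠ 0 ∧
      2 * prof s₀ e n (b n) + (m n).toNat ≤ prof s₀ e (n + 1) (b (n + 1)) := by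
  have key : ∀ n, prof s₀ e n (b n) ≠ 0 →
      2 * prof s₀ e n (b n) + (m n).toNat ≤ prof s₀ e (n + 1) (b (n + 1)) := fun n hn => by
    have := le_pstep (e n) (prof s₀ e n) (b n) (b (n + 1))
    rwa [hb n, extVal_some hn] at this
  have hne : prof s₀ e n (b n) ≠ 0 := by
    induction n with
    | zero => simp [prof, h0]
    | succ n ih => have := key n ih; omega
  exact ⟨hne, key n hne⟩

end Profile

/-- The longest common prefix of two binary expansions of the same length. -/
def lcp (a b : ℕ) : ℕ := if a = b then a else lcp (a / 2) (b / 2)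
termination_by a + b
decreasing_by omega

theorem lcp_self (a : ℕ) : lcp a a = a := by rw [lcp, if_pos rfl]

theorem lcp_of_ne {a b : ℕ} (h : a ≠ b) : lcp a b = lcp (a / 2) (b / 2) := by
  rw [lcp, if_neg h]

theorem lcp_double {a b i j : ℕ} (h : a ≠ b) (hi : i ≤ 1) (hj : j ≤ 1) :
    lcp (2 * a + i) (2 * b + j) = lcp a b := by
  rw [lcp_of_ne (by omega), show (2 * a + i) / 2 = a by omega, show (2 * b + j) / 2 = b by omega]

theorem lcp_siblings (a : ℕ) : lcp (2 * a) (2 * a + 1) = a := by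
  rw [lcp_of_ne (by omega), show 2 * a / 2 = a by omega, show (2 * a + 1) / 2 = a by omega,
    lcp_self]

theorem exists_div_pow_of_lt {a b : ℕ} (h : a < b) :
    ∃ d, a / 2 ^ d = 2 * lcp a b ∧ b / 2 ^ d = 2 * lcp a b + 1 := by
  induction b using Nat.strong_induction_on generalizing a with
  | _ b ih =>
    rw [lcp_of_ne h.ne]
    by_cases heq : a / 2 = b / 2
    · refine ⟨0, ?_⟩
      rw [heq, lcp_self]
      omega
    · obtain ⟨d, h1, h2⟩ := ih (b / 2) (by omega) (a := a / 2) (by omega)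
      refine ⟨d + 1, ?_⟩
      rw [pow_succ', ← Nat.div_div_eq_div_mul, ← Nat.div_div_eq_div_mul]
      exact ⟨h1, h2⟩

theorem lcp_eq_of_div_pow {a b u d : ℕ} (ha : a / 2 ^ d = 2 * u) (hb : b / 2 ^ d = 2 * u + 1) :
    lcp a b = u := by
  induction d generalizing a b with
  | zero =>
    simp only [pow_zero, Nat.div_one] at ha hb
    rw [ha, hb, lcp_siblings]
  | succ d ih =>
    rw [lcp_of_ne (by rintro rfl; omega)]
    rw [pow_succ', ← Nat.div_div_eq_div_mul] at ha hb
    exact ih ha hb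

theorem le_lcp_of_div_pow {a b v d : ℕ} (ha : a / 2 ^ d = v) (hb : b / 2 ^ d = v) :
    v ≤ lcp a b := by
  induction d generalizing a b with
  | zero =>
    simp only [pow_zero, Nat.div_one] at ha hb
    rw [ha, hb, lcp_self]
  | succ d ih =>
    by_cases hab : a = b
    · rw [hab, lcp_self, ← hb]
      exact Nat.div_le_self _ _
    · rw [lcp_of_ne hab]
      rw [pow_succ', ← Nat.div_div_eq_div_mul] at ha hb
      exact ih ha hb

theorem lt_of_div_pow_lt {a b d : ℕ} (h : a / 2 ^ d < b / 2 ^ d) : a < b := by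
  by_contra hle
  exact absurd (Nat.div_le_div_right (c := 2 ^ d) (not_lt.mp hle)) (not_le.mpr h)

theorem lcp_le_of_div_pow {a b u d : ℕ} (hb : b / 2 ^ d = 2 * u + 1) (hab : a < b)
    (ha : a / 2 ^ d ≠ 2 * u + 1) : lcp a b ≤ u := by
  by_contra hlt
  obtain ⟨c, hc1, hc2⟩ := exists_div_pow_of_lt hab
  rcases le_or_gt d c with hdc | hdc
  · obtain ⟨f, rfl⟩ := Nat.exists_eq_add_of_le hdc
    rw [pow_add, ← Nat.div_div_eq_div_mul, hb] at hc2
    have := Nat.div_le_self (2 * u + 1) (2 ^ f)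
    omega
  · obtain ⟨f, hf⟩ := Nat.exists_eq_add_of_lt hdc
    refine ha ?_
    rw [← hb, hf, add_assoc, pow_add, ← Nat.div_div_eq_div_mul, ← Nat.div_div_eq_div_mul, hc1,
      hc2, pow_succ', ← Nat.div_div_eq_div_mul, ← Nat.div_div_eq_div_mul]
    congr 1
    omega

theorem lcp_le_of_le {a b c : ℕ} (hab : a < b) (hbc : b ≤ c) : lcp a c ≤ lcp a b := by
  obtain ⟨d, ha, hc⟩ := exists_div_pow_of_lt (hab.trans_le hbc)
  have h1 := Nat.div_le_div_right (c := 2 ^ d) hab.le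
  have h2 := Nat.div_le_div_right (c := 2 ^ d) hbc
  by_cases hb : b / 2 ^ d = 2 * lcp a c
  · have := le_lcp_of_div_pow ha hb
    omega
  · exact (lcp_eq_of_div_pow ha (by omega : b / 2 ^ d = 2 * lcp a c + 1)).ge

theorem pow_interval_unique {x a b : ℕ} (h1 : 2 ^ a ≤ x) (h2 : x < 2 ^ (a + 1)) (h3 : 2 ^ b ≤ x)
    (h4 : x < 2 ^ (b + 1)) : a = b := by
  have h5 := (Nat.pow_lt_pow_iff_right (a := 2) (by omega)).mp (lt_of_le_of_lt h1 h4)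
  have h6 := (Nat.pow_lt_pow_iff_right (a := 2) (by omega)).mp (lt_of_le_of_lt h3 h2)
  omega

/-- The branching nodes of the binary tree spanned by the values of a profile. -/
def branch {S : Type} [Fintype S] (p : S → ℕ) : Finset ℕ :=
  ((Finset.univ : Finset (S × S)).filter fun a => p a.1 < p a.2).image
    fun a => lcp (p a.1) (p a.2)

/-- `t` has the least value above the branching node `u`. -/
def IsLeastAbove {S : Type} (p : S → ℕ) (t : S) (u : ℕ) : Prop :=
  (∃ s, p s < p t ∧ lcp (p s) (p t) = u) ∧ ∀ r, p r < p t → lcp (p r) (p t) ≤ u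

/-- The least value above `u` increases when passing from `p` to `p'`. -/
def Flash {S : Type} (p p' : S → ℕ) (u : ℕ) : Prop :=
  ∃ t, IsLeastAbove p t u ∧ ∀ x, p' x ≠ 2 * p t

section Branch

variable {S : Type} [Fintype S]

theorem mem_branch {p : S → ℕ} {u : ℕ} :
    u ∈ branch p ↔ ∃ s t, p s < p t ∧ lcp (p s) (p t) = u := by
  simp [branch]

variable {z : S} {n : ℕ} {p : S → ℕ}

theorem lt_of_mem_branch (hp : ValidProfile z n p) {u : ℕ} (hu : u ∈ branch p) : u < 2 ^ n := by
  obtain ⟨s, t, hlt, rfl⟩ := mem_branch.mp hu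
  obtain ⟨d, -, h⟩ := exists_div_pow_of_lt hlt
  have h1 := Nat.div_le_self (p t) (2 ^ d)
  have h2 := hp.2 t
  rw [pow_succ] at h2
  omega

theorem mem_branch_of_succ (hp : ValidProfile z n p) {p' : S → ℕ}
    (hpar : ∀ y, ∃ x b, b ≤ 1 ∧ (p x = 0 → b = 0) ∧ p' y = 2 * p x + b) {u : ℕ} (hu : u < 2 ^ n)
    (hu' : u ∈ branch p') : u ∈ branch p := by
  obtain ⟨s, t, hlt, rfl⟩ := mem_branch.mp hu'
  obtain ⟨x, b, hb, -, hx⟩ := hpar s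
  obtain ⟨y, c, hc, hc0, hy⟩ := hpar t
  rw [hx, hy] at hlt hu ⊢
  by_cases hxy : p x = p y
  · obtain rfl : b = 0 := by omega
    obtain rfl : c = 1 := by omega
    rw [hxy, add_zero, lcp_siblings] at hu
    have := hp.2 y
    omega
  · rw [lcp_double hxy hb hc]
    exact mem_branch.mpr ⟨x, y, by omega, rfl⟩

theorem mem_branch_iff (hp : ValidProfile z n p) {u j : ℕ} (h1 : 2 ^ j ≤ 2 * u + 1)
    (h2 : 2 * u + 1 < 2 ^ (j + 1)) (hj : j ≤ n) : u ∈ branch p ↔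
      (∃ s, p s / 2 ^ (n - j) = 2 * u) ∧ ∃ t, p t / 2 ^ (n - j) = 2 * u + 1 := by
  rw [mem_branch]
  constructor
  · rintro ⟨s, t, hlt, rfl⟩
    obtain ⟨d, hs, ht⟩ := exists_div_pow_of_lt hlt
    have h3 := (hp.2 t).resolve_left (by omega)
    have h4 : 2 ^ (j + d) ≤ p t := by
      rw [pow_add, ← Nat.le_div_iff_mul_le (by positivity), ht]
      exact h1
    have h5 : p t < 2 ^ (j + d + 1) := by
      rw [add_right_comm, pow_add, ← Nat.div_lt_iff_lt_mul (by positivity), ht]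
      exact h2
    have h6 := pow_interval_unique h4 h5 h3.1 h3.2
    rw [show n - j = d by omega]
    exact ⟨⟨s, hs⟩, t, ht⟩
  · rintro ⟨⟨s, hs⟩, t, ht⟩
    exact ⟨s, t, lt_of_div_pow_lt (d := n - j) (by omega), lcp_eq_of_div_pow hs ht⟩

theorem isLeastAbove_iff (hp : ValidProfile z n p) {u j : ℕ} (h1 : 2 ^ j ≤ 2 * u + 1)
    (h2 : 2 * u + 1 < 2 ^ (j + 1)) (hj : j ≤ n) (hu : u ∈ branch p) {t : S} :
    IsLeastAbove p t u ↔ p t / 2 ^ (n - j) = 2 * u + 1 ∧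
      ∀ x, p x / 2 ^ (n - j) = 2 * u + 1 → p t ≤ p x := by
  constructor
  · rintro ⟨⟨s, hlt, hl⟩, hle⟩
    obtain ⟨d, -, ht⟩ := exists_div_pow_of_lt hlt
    rw [hl] at ht
    have h3 := (hp.2 t).resolve_left (by omega)
    have h4 : 2 ^ (j + d) ≤ p t := by
      rw [pow_add, ← Nat.le_div_iff_mul_le (by positivity), ht]
      exact h1
    have h5 : p t < 2 ^ (j + d + 1) := by
      rw [add_right_comm, pow_add, ← Nat.div_lt_iff_lt_mul (by positivity), ht]
      exact h2
    have h6 := pow_interval_unique h4 h5 h3.1 h3.2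
    obtain rfl : n - j = d := by omega
    refine ⟨ht, fun x hx => ?_⟩
    by_contra hlt'
    have h7 := hle x (not_le.mp hlt')
    have h8 := le_lcp_of_div_pow hx ht
    omega
  · rintro ⟨ht, hmin⟩
    obtain ⟨s, hs⟩ := ((mem_branch_iff hp h1 h2 hj).mp hu).1
    refine ⟨⟨s, lt_of_div_pow_lt (d := n - j) (by omega), lcp_eq_of_div_pow hs ht⟩,
      fun r hr => ?_⟩
    exact lcp_le_of_div_pow ht hr fun h => absurd (hmin r h) (not_le.mpr hr)

theorem exists_isLeastAbove (hp : ValidProfile z n p) {u j : ℕ} (h1 : 2 ^ j ≤ 2 * u + 1)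
    (h2 : 2 * u + 1 < 2 ^ (j + 1)) (hj : j ≤ n) (hu : u ∈ branch p) :
    ∃ t, IsLeastAbove p t u := by
  have hne := ((mem_branch_iff hp h1 h2 hj).mp hu).2
  obtain ⟨t, ht, hmin⟩ := Set.exists_min_image {t | p t / 2 ^ (n - j) = 2 * u + 1} p
    (Set.toFinite _) hne
  exact ⟨t, (isLeastAbove_iff hp h1 h2 hj hu).mpr ⟨ht, hmin⟩⟩

end Branch

section Sequence

variable {S : Type} [Fintype S] {z : S} {p : ℕ → S → ℕ}

theorem succ_div_pow {a b i n j : ℕ} (hi : i ≤ 1) (hj : j ≤ n) (h : b = 2 * a + i) :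
    b / 2 ^ (n + 1 - j) = a / 2 ^ (n - j) := by
  rw [show n + 1 - j = n - j + 1 by omega, pow_succ', ← Nat.div_div_eq_div_mul,
    show b / 2 = a by omega]

theorem exists_level (u : ℕ) : ∃ j, 2 ^ j ≤ 2 * u + 1 ∧ 2 * u + 1 < 2 ^ (j + 1) :=
  ⟨Nat.log 2 (2 * u + 1), Nat.pow_log_le_self 2 (by omega), Nat.lt_pow_succ_log_self (by omega) _⟩

theorem level_le {u j n : ℕ} (h1 : 2 ^ j ≤ 2 * u + 1) (hu : u < 2 ^ n) : j ≤ n := by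
  have : 2 ^ j < 2 ^ (n + 1) := by rw [pow_succ]; omega
  have := (Nat.pow_lt_pow_iff_right (a := 2) (by omega)).mp this
  omega

/-- The least values above a persistent branching node at least double in each step, and do more
than that whenever the node flashes. -/
theorem exists_growing_of_flash (hval : ∀ n, ValidProfile z n (p n))
    (hpar : ∀ n y, ∃ x b, b ≤ 1 ∧ (p n x = 0 → b = 0) ∧ p (n + 1) y = 2 * p n x + b)
    {u N : ℕ} (hu : ∀ n, N ≤ n → u ∈ branch (p n)) :
    ∃ t : ℕ → S, (∀ n, N ≤ n → IsLeastAbove (p n) (t n) u) ∧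
      (∀ n, N ≤ n → p n (t n) ≠ 0) ∧
      (∀ n, N ≤ n → 2 * p n (t n) ≤ p (n + 1) (t (n + 1))) ∧
      ∀ n, N ≤ n →
        (Flash (p n) (p (n + 1)) u ↔ 2 * p n (t n) < p (n + 1) (t (n + 1))) := by
  obtain ⟨j, h1, h2⟩ := exists_level u
  have hj : ∀ n, N ≤ n → j ≤ n := fun n hn =>
    level_le h1 (lt_of_mem_branch (hval n) (hu n hn))
  have hex : ∀ n, ∃ t, N ≤ n → IsLeastAbove (p n) t u := fun n => by
    by_cases hn : N ≤ n
    · obtain ⟨t, ht⟩ := exists_isLeastAbove (hval n) h1 h2 (hj n hn) (hu n hn)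
      exact ⟨t, fun _ => ht⟩
    · exact ⟨z, fun h => absurd h hn⟩
  choose t ht using hex
  have hiff : ∀ n, N ≤ n → ∀ s, IsLeastAbove (p n) s u ↔ p n s / 2 ^ (n - j) = 2 * u + 1 ∧
      ∀ x, p n x / 2 ^ (n - j) = 2 * u + 1 → p n s ≤ p n x := fun n hn s =>
    isLeastAbove_iff (hval n) h1 h2 (hj n hn) (hu n hn)
  have hdbl : ∀ n, N ≤ n → 2 * p n (t n) ≤ p (n + 1) (t (n + 1)) := fun n hn => by
    obtain ⟨x, b, hb, -, hx⟩ := hpar n (t (n + 1))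
    have h3 := ((hiff (n + 1) (by omega) _).mp (ht (n + 1) (by omega))).1
    rw [succ_div_pow hb (hj n hn) hx] at h3
    have := ((hiff n hn _).mp (ht n hn)).2 x h3
    omega
  refine ⟨t, ht, fun n hn h0 => ?_, hdbl, fun n hn => ⟨?_, fun hlt => ⟨t n, ht n hn, ?_⟩⟩⟩
  · have := ((hiff n hn _).mp (ht n hn)).1
    simp [h0] at this
  · rintro ⟨s, hs, hne⟩
    have h3 := ((hiff n hn _).mp hs)
    have h4 := ((hiff n hn _).mp (ht n hn))
    have h5 : p n s = p n (t n) := le_antisymm (h3.2 _ h4.1) (h4.2 _ h3.1)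
    refine lt_of_le_of_ne (hdbl n hn) fun h => hne (t (n + 1)) ?_
    rw [h5, h]
  · intro x hx
    have h3 := ((hiff n hn _).mp (ht n hn)).1
    have h4 := ((hiff (n + 1) (by omega) _).mp (ht (n + 1) (by omega))).2 x (by
      rw [succ_div_pow (i := 0) (by omega) (hj n hn) hx, h3])
    omega

/-- A path with infinitely many marks along which the values are attained produces a persistent
branching node that flashes infinitely often. -/
theorem exists_flash_of_path (hval : ∀ n, ValidProfile z n (p n))
    (hpar : ∀ n y, ∃ x b, b ≤ 1 ∧ (p n x = 0 → b = 0) ∧ p (n + 1) y = 2 * p n x + b)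
    {b : ℕ → S} {m : ℕ → Bool} (hb0 : p 0 (b 0) ≠ 0)
    (hb : ∀ n, p (n + 1) (b (n + 1)) = 2 * p n (b n) + (m n).toNat)
    (hm : InfOften fun n => m n = true) :
    ∃ u N, (∀ n, N ≤ n → u ∈ branch (p n)) ∧
      InfOften fun n => Flash (p n) (p (n + 1)) u := by
  have hpos : ∀ n, p n (b n) ≠ 0 := by
    intro n
    induction n with
    | zero => exact hb0
    | succ n ih => rw [hb]; omega
  have hX : ∀ j n, j ≤ n → p n (b n) / 2 ^ (n - j) = p j (b j) := by
    intro j n hn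
    induction n, hn using Nat.le_induction with
    | base => simp
    | succ n hn ih => rw [succ_div_pow (Bool.toNat_le (m n)) hn (hb n), ih]
  let G : Set ℕ := {j | Odd (p j (b j)) ∧ ∀ n, j ≤ n → ∃ s, p n s / 2 ^ (n - j) = p j (b j) - 1}
  have hG0 : 0 ∈ G := by
    have h1 := ((hval 0).2 (b 0)).resolve_left hb0
    have h2 : p 0 (b 0) = 1 := by omega
    refine ⟨by rw [h2]; exact odd_one, fun n _ => ⟨z, ?_⟩⟩
    rw [(hval n).1, h2, Nat.zero_div]
  have hGfin : G.Finite := by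
    by_contra hinf
    obtain ⟨F, hFG, hF⟩ := Set.Infinite.exists_subset_card_eq hinf (Fintype.card S + 1)
    have hs : ∀ j, ∃ s, j ∈ F → p (F.sup id) s / 2 ^ (F.sup id - j) = p j (b j) - 1 := by
      intro j
      by_cases hj : j ∈ F
      · obtain ⟨s, hs⟩ := (hFG hj).2 (F.sup id) (Finset.le_sup (f := id) hj)
        exact ⟨s, fun _ => hs⟩
      · exact ⟨z, fun h => absurd h hj⟩
    choose s hs using hs
    have hne : ∀ i ∈ F, ∀ j ∈ F, i < j → s i ≠ s j := by
      intro i hi j hj hij heq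
      have h1 := hs i hi
      have h2 := hs j hj
      have h3 := Finset.le_sup (f := id) hj
      rw [id] at h3
      obtain ⟨f, rfl⟩ := Nat.exists_eq_add_of_lt hij
      rw [heq, show F.sup id - i = F.sup id - (i + f + 1) + (f + 1) by omega, pow_add,
        ← Nat.div_div_eq_div_mul, h2] at h1
      have h4 := hX i (i + f + 1) (by omega)
      obtain ⟨r, hr⟩ := (hFG hj).1
      rw [show i + f + 1 - i = f + 1 by omega, pow_succ', ← Nat.div_div_eq_div_mul] at h4
      rw [pow_succ', ← Nat.div_div_eq_div_mul] at h1
      rw [hr, show (2 * r + 1 - 1) / 2 = r by omega] at h1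
      rw [hr, show (2 * r + 1) / 2 = r by omega] at h4
      have := hpos i
      omega
    have hinj : Set.InjOn s F := by
      intro i hi j hj hij
      rcases lt_trichotomy i j with h | h | h
      · exact absurd hij (hne i hi j hj h)
      · exact h
      · exact absurd hij.symm (hne j hj i hi h)
    have := Finset.card_le_card_of_injOn (t := Finset.univ) s (fun _ _ => Finset.mem_univ _) hinj
    rw [hF, Finset.card_univ] at this
    omega
  obtain ⟨j₀, hj₀, hmax⟩ := Set.exists_max_image G id hGfin ⟨0, hG0⟩
  obtain ⟨⟨u, hu⟩, hleft⟩ := hj₀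
  have hv := ((hval j₀).2 (b j₀)).resolve_left (hpos j₀)
  rw [hu] at hv hleft
  have hbr : ∀ n, j₀ ≤ n → u ∈ branch (p n) := fun n hn =>
    (mem_branch_iff (hval n) hv.1 hv.2 hn).mpr
      ⟨hleft n hn, b n, (hX j₀ n hn).trans hu⟩
  refine ⟨u, j₀, hbr, ?_⟩
  obtain ⟨t, ht, -, hdbl, hflash⟩ := exists_growing_of_flash hval hpar hbr
  have hmin : ∀ n, j₀ ≤ n → p n (t n) / 2 ^ (n - j₀) = 2 * u + 1 ∧
      ∀ x, p n x / 2 ^ (n - j₀) = 2 * u + 1 → p n (t n) ≤ p n x := fun n hn =>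
    (isLeastAbove_iff (hval n) hv.1 hv.2 hn (hbr n hn)).mp (ht n hn)
  have hle : ∀ n, j₀ ≤ n → p n (t n) ≤ p n (b n) := fun n hn =>
    (hmin n hn).2 _ ((hX j₀ n hn).trans hu)
  by_contra hcon
  obtain ⟨N, hN⟩ := not_infOften_iff.mp hcon
  have hdouble : ∀ d, p (max N j₀ + d) (t (max N j₀ + d)) =
      2 ^ d * p (max N j₀) (t (max N j₀)) := by
    intro d
    induction d with
    | zero => simp
    | succ d ih =>
      have h1 := hdbl (max N j₀ + d) (by omega)
      have h2 := mt (hflash (max N j₀ + d) (by omega)).mpr (hN _ (by omega))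
      rw [← add_assoc, pow_succ', mul_assoc, ← ih]
      omega
  have hconv : ∀ i, j₀ ≤ i → ∃ K, ∀ n, K ≤ n → i ≤ n → p n (t n) / 2 ^ (n - i) = p i (b i) := by
    intro i hi
    induction i, hi using Nat.le_induction with
    | base => exact ⟨0, fun n _ hn => ((hmin n hn).1).trans hu.symm⟩
    | succ i hi ih =>
      obtain ⟨K, hK⟩ := ih
      have hstep : ∀ n, K ≤ n → i + 1 ≤ n → p n (t n) / 2 ^ (n - (i + 1)) / 2 = p i (b i) ∧
          p n (t n) / 2 ^ (n - (i + 1)) ≤ p (i + 1) (b (i + 1)) := by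
        intro n hn hin
        have h1 := hK n hn (by omega)
        rw [show n - i = n - (i + 1) + 1 by omega, pow_succ, ← Nat.div_div_eq_div_mul] at h1
        refine ⟨h1, ?_⟩
        rw [← hX (i + 1) n hin]
        exact Nat.div_le_div_right (hle n (by omega))
      have hbi := hb i
      cases hmi : m i with
      | false =>
        rw [hmi, Bool.toNat_false] at hbi
        refine ⟨K, fun n hn hin => ?_⟩
        have := hstep n hn hin
        omega
      | true =>
        rw [hmi, Bool.toNat_true] at hbi
        have hnG : i + 1 ∉ G := fun h => by
          have := hmax _ h
          simp only [id] at this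
          omega
        have hnG' : ∃ n₁, i + 1 ≤ n₁ ∧ ∀ s, p n₁ s / 2 ^ (n₁ - (i + 1)) ≠ 2 * p i (b i) := by
          by_contra hall
          push Not at hall
          refine hnG ⟨⟨p i (b i), hbi⟩, fun n hn => ?_⟩
          obtain ⟨s, hs⟩ := hall n hn
          exact ⟨s, by rw [hs, hbi]; omega⟩
        obtain ⟨n₁, hn₁, hno⟩ := hnG'
        have hno' : ∀ n, n₁ ≤ n → ∀ s, p n s / 2 ^ (n - (i + 1)) ≠ 2 * p i (b i) := by
          intro n hn
          induction n, hn using Nat.le_induction with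
          | base => exact hno
          | succ n hn ih =>
            intro s
            obtain ⟨x, c, hc, -, hx⟩ := hpar n s
            rw [succ_div_pow hc (by omega) hx]
            exact ih x
        refine ⟨max K n₁, fun n hn hin => ?_⟩
        have h1 := hstep n (by omega) hin
        have h2 := hno' n (by omega) (t n)
        omega
  obtain ⟨i, hi, hmi⟩ := hm (max N j₀)
  obtain ⟨K, hK⟩ := hconv (i + 1) (by omega)
  have h1 := hK (max K (i + 1)) (by omega) (by omega)
  obtain ⟨d, hd⟩ := Nat.exists_eq_add_of_le (show max N j₀ ≤ max K (i + 1) by omega)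
  have h2 := hdouble d
  rw [← hd] at h2
  obtain ⟨f, hf⟩ := Nat.exists_eq_add_of_lt (show max N j₀ < i + 1 by omega)
  have hd' : d = max K (i + 1) - (i + 1) + (f + 1) := by omega
  rw [h2, hd', pow_add, mul_assoc, Nat.mul_div_cancel_left _ (by positivity), hb i, hmi,
    pow_succ', mul_assoc] at h1
  simp only [Bool.toNat_true] at h1
  omega

end Sequence

section Priority

variable {S : Type} [Fintype S]

/-- The number of branching nodes below `u`. -/
def rank (p : S → ℕ) (u : ℕ) : ℕ := ((branch p).filter (· < u)).card

theorem rank_le (p : S → ℕ) (u : ℕ) : rank p u ≤ Fintype.card (S × S) :=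
  (Finset.card_filter_le _ _).trans (Finset.card_image_le.trans (Finset.card_filter_le _ _))

theorem rank_mono (p : S → ℕ) {u v : ℕ} (h : u ≤ v) : rank p u ≤ rank p v :=
  Finset.card_le_card fun _ hx => by
    simp only [Finset.mem_filter] at hx ⊢
    exact ⟨hx.1, hx.2.trans_le h⟩

theorem rank_lt {p : S → ℕ} {u v : ℕ} (hu : u ∈ branch p) (h : u < v) : rank p u < rank p v :=
  Finset.card_lt_card <| Finset.ssubset_iff_subset_ne.mpr ⟨fun _ hx => by
    simp only [Finset.mem_filter] at hx ⊢
    exact ⟨hx.1, hx.2.trans h⟩, fun heq => by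
    have : u ∈ (branch p).filter (· < v) := Finset.mem_filter.mpr ⟨hu, h⟩
    rw [← heq] at this
    simp at this⟩

open Classical in
/-- The priority contributed by the branching node `u`: even if it disappears, odd if its least
value increases, and larger for smaller nodes. -/
noncomputable def weight (p p' : S → ℕ) (u : ℕ) : ℕ :=
  if u ∉ branch p' then 2 * (Fintype.card (S × S) - rank p u) + 2
  else if Flash p p' u then 2 * (Fintype.card (S × S) - rank p u) + 1 else 0

/-- The priority of the transition from the profile `p` to the profile `p'`. -/
noncomputable def priority (p p' : S → ℕ) : ℕ := (branch p).sup (weight p p')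

theorem weight_le (p p' : S → ℕ) (u : ℕ) :
    weight p p' u ≤ 2 * (Fintype.card (S × S) - rank p u) + 2 := by
  unfold weight; split_ifs <;> omega

theorem weight_of_mem {p p' : S → ℕ} {u : ℕ} (h : u ∈ branch p') : weight p p' u = 0 ∨
    (Flash p p' u ∧ weight p p' u = 2 * (Fintype.card (S × S) - rank p u) + 1) := by
  unfold weight
  rw [if_neg (not_not.mpr h)]
  split_ifs with hf
  · exact Or.inr ⟨hf, rfl⟩
  · exact Or.inl rfl

theorem priority_lt (p p' : S → ℕ) : priority p p' < 2 * Fintype.card (S × S) + 3 := by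
  refine Nat.lt_succ_of_le (Finset.sup_le fun u _ => ?_)
  have := weight_le p p' u
  omega

theorem weight_le_priority {p p' : S → ℕ} {u : ℕ} (hu : u ∈ branch p) :
    weight p p' u ≤ priority p p' := Finset.le_sup hu

theorem exists_weight_eq {p p' : S → ℕ} (h : priority p p' ≠ 0) :
    ∃ u ∈ branch p, weight p p' u = priority p p' := by
  obtain ⟨u, hu, heq⟩ := Finset.exists_mem_eq_sup (branch p) (by
    by_contra hne
    rw [Finset.not_nonempty_iff_eq_empty] at hne
    exact h (by simp [priority, hne])) (weight p p')
  exact ⟨u, hu, heq.symm⟩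

variable {z : S} {p : ℕ → S → ℕ}

theorem filter_branch_succ_subset (hval : ∀ n, ValidProfile z n (p n))
    (hpar : ∀ n y, ∃ x b, b ≤ 1 ∧ (p n x = 0 → b = 0) ∧ p (n + 1) y = 2 * p n x + b)
    {u n : ℕ} (hu : u ∈ branch (p n)) :
    (branch (p (n + 1))).filter (· < u) ⊆ (branch (p n)).filter (· < u) := fun v hv => by
  simp only [Finset.mem_filter] at hv ⊢
  have := lt_of_mem_branch (hval n) hu
  exact ⟨mem_branch_of_succ (hval n) (hpar n) (by omega) hv.1, hv.2⟩

/-- The sequence of priorities is rejecting if and only if some branching node persists and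
flashes infinitely often. -/
theorem parityAcc_priority_iff (hval : ∀ n, ValidProfile z n (p n))
    (hpar : ∀ n y, ∃ x b, b ≤ 1 ∧ (p n x = 0 → b = 0) ∧ p (n + 1) y = 2 * p n x + b) :
    ParityAcc (fun n => priority (p n) (p (n + 1))) ↔
      ¬ ∃ u N, (∀ n, N ≤ n → u ∈ branch (p n)) ∧
        InfOften fun n => Flash (p n) (p (n + 1)) u := by
  obtain ⟨q, hq, N₀, hN₀⟩ := exists_max_infOften (N := 0)
    (c := fun n => priority (p n) (p (n + 1))) fun n _ => priority_lt _ _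
  constructor
  · rintro hacc ⟨u, N, hu, hflash⟩
    obtain ⟨N', hN', hconst⟩ := eventually_const_of_antitone (f := fun n => rank (p n) u) (N := N)
      fun n hn => Finset.card_le_card (filter_branch_succ_subset hval hpar (hu n hn))
    have hkeep : ∀ n, N' ≤ n → ∀ v ∈ branch (p n), v ≤ u → v ∈ branch (p (n + 1)) := by
      intro n hn v hv hvu
      rcases hvu.lt_or_eq with hlt | rfl
      · have heq := Finset.eq_of_subset_of_card_le
          (filter_branch_succ_subset hval hpar (hu n (by omega)))
          (((hconst n hn).trans (hconst (n + 1) (by omega)).symm).le)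
        have : v ∈ (branch (p n)).filter (· < u) := Finset.mem_filter.mpr ⟨hv, hlt⟩
        rw [← heq] at this
        exact (Finset.mem_filter.mp this).1
      · exact hu _ (by omega)
    have hodd : ∀ n, N' ≤ n →
        2 * (Fintype.card (S × S) - rank (p N') u) < priority (p n) (p (n + 1)) →
        Odd (priority (p n) (p (n + 1))) := by
      intro n hn hlt
      obtain ⟨v, hv, heq⟩ := exists_weight_eq (Nat.ne_zero_of_lt hlt)
      have hr := hconst n hn
      rcases le_or_gt v u with hvu | hvu
      · rcases weight_of_mem (p := p n) (hkeep n hn v hv hvu) with h | ⟨-, h⟩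
        · omega
        · exact ⟨_, heq.symm.trans h⟩
      · have h1 := rank_lt (hu n (by omega)) hvu
        have h2 := rank_le (p n) v
        have h3 := weight_le (p n) (p (n + 1)) v
        omega
    have hge : ∀ n, N' ≤ n → Flash (p n) (p (n + 1)) u →
        2 * (Fintype.card (S × S) - rank (p N') u) < priority (p n) (p (n + 1)) := by
      intro n hn hf
      have h1 := weight_le_priority (p' := p (n + 1)) (hu n (by omega))
      have hr := hconst n hn
      rw [weight, if_neg (not_not.mpr (hu (n + 1) (by omega))), if_pos hf, hr] at h1
      omega
    obtain ⟨n, hn, hf⟩ := hflash (max N' N₀)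
    obtain ⟨n', hn', hqn⟩ := hq N'
    have h1 := hge n (by omega) hf
    have h2 := hN₀ n (by omega)
    have h3 := hodd n' hn' (by omega)
    exact not_parityAcc_of_odd (hqn ▸ h3) hq (fun r hr => not_infOften_of_le hN₀ hr) hacc
  · intro hno
    by_contra hacc
    refine hno ?_
    have hodd : ¬ Even q := fun he => hacc ⟨q, he, hq, fun r hr => not_infOften_of_le hN₀ hr⟩
    have hattain : ∀ n, priority (p n) (p (n + 1)) = q → ∃ u ∈ branch (p n),
        Flash (p n) (p (n + 1)) u ∧ q = 2 * (Fintype.card (S × S) - rank (p n) u) + 1 := by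
      intro n hn
      obtain ⟨u, hu, heq⟩ := exists_weight_eq (p := p n) (p' := p (n + 1)) (by
        rw [hn]
        rintro rfl
        exact hodd Even.zero)
      rw [hn] at heq
      by_cases hk : u ∈ branch (p (n + 1))
      · rcases weight_of_mem (p := p n) hk with h | ⟨hf, h⟩
        · exact absurd (by rw [← heq, h]; exact Even.zero) hodd
        · exact ⟨u, hu, hf, by omega⟩
      · rw [weight, if_pos hk] at heq
        exact absurd ⟨Fintype.card (S × S) - rank (p n) u + 1, by omega⟩ hodd
    obtain ⟨n₀, hn₀, hqn₀⟩ := hq N₀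
    obtain ⟨u, hu, -, hqu⟩ := hattain n₀ hqn₀
    have hpers : ∀ n, n₀ ≤ n → u ∈ branch (p n) ∧ rank (p n) u = rank (p n₀) u := by
      intro n hn
      induction n, hn using Nat.le_induction with
      | base => exact ⟨hu, rfl⟩
      | succ n hn ih =>
        have hkeep : ∀ v ∈ branch (p n), v ≤ u → v ∈ branch (p (n + 1)) := by
          intro v hv hvu
          by_contra hk
          have h1 := weight_le_priority (p' := p (n + 1)) hv
          rw [weight, if_pos hk] at h1
          have h2 := hN₀ n (by omega)
          have h3 := rank_mono (p n) hvu
          have h4 := rank_le (p n) u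
          omega
        refine ⟨hkeep u ih.1 le_rfl, ?_⟩
        rw [← ih.2]
        refine le_antisymm (Finset.card_le_card (filter_branch_succ_subset hval hpar ih.1))
          (Finset.card_le_card fun v hv => ?_)
        simp only [Finset.mem_filter] at hv ⊢
        exact ⟨hkeep v hv.1 hv.2.le, hv.2⟩
    refine ⟨u, n₀, fun n hn => (hpers n hn).1, hq.mono n₀ fun n hn hqn => ?_⟩
    obtain ⟨v, hv, hf, hqv⟩ := hattain n hqn
    obtain ⟨h1, h2⟩ := hpers n hn
    have h3 := rank_le (p n) v
    have h4 := rank_le (p n) u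
    have h5 : rank (p n) v = rank (p n) u := by omega
    rcases lt_trichotomy u v with h | rfl | h
    · exact absurd (rank_lt h1 h) (by omega)
    · exact hf
    · exact absurd (rank_lt hv h) (by omega)

end Priority

section MarkedPaths

variable {S : Type} [Fintype S] {s₀ z : S} {e : ℕ → S → S → Option Bool}

theorem prof_parents (hz : z ≠ s₀) (he : ∀ n x, e n x z = none) (n : ℕ) (y : S) :
    ∃ x b, b ≤ 1 ∧ (prof s₀ e n x = 0 → b = 0) ∧ prof s₀ e (n + 1) y = 2 * prof s₀ e n x + b := by
  have hp := (validProfile_prof hz he n).1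
  obtain ⟨par, bit, h⟩ := exists_parents (fun _ _ => Iff.rfl) hp hp (e n)
  exact ⟨par y, bit y, (h y).1, (h y).2.1, (h y).2.2.1⟩

/-- The priorities along the profiles are accepting if and only if no path has infinitely many
marks. -/
theorem parityAcc_prof_iff (hz : z ≠ s₀) (he : ∀ n x, e n x z = none) :
    ParityAcc (fun n => priority (prof s₀ e n) (prof s₀ e (n + 1))) ↔
      ¬ ∃ (b : ℕ → S) (m : ℕ → Bool), b 0 = s₀ ∧ (∀ i, e i (b i) (b (i + 1)) = some (m i)) ∧
        InfOften fun i => m i = true := by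
  have hval := validProfile_prof hz he
  have hpar := prof_parents hz he
  rw [parityAcc_priority_iff hval hpar, not_iff_not]
  constructor
  · rintro ⟨u, N, hu, hf⟩
    obtain ⟨t, -, hpos, hdbl, hiff⟩ := exists_growing_of_flash hval hpar hu
    obtain ⟨b, h0, hb, hm⟩ := exists_tight_path s₀ e hpos hdbl
      (hf.mono N fun n hn h => (hiff n hn).mp h)
    choose m hm1 _ _ using hb
    exact ⟨b, m, h0, hm1, hm.mono 0 fun n _ h => by rw [hm1] at h; exact Option.some.inj h⟩
  · rintro ⟨b, m, h0, hb, hm⟩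
    obtain ⟨b', h0', hb', hm'⟩ := exists_tight_path s₀ e (s := b) (N := 0)
      (fun n _ => (prof_path s₀ e h0 hb n).1)
      (fun n _ => by have := (prof_path s₀ e h0 hb n).2; omega)
      (hm.mono 0 fun n _ h => by
        have := (prof_path s₀ e h0 hb n).2
        rw [h, Bool.toNat_true] at this
        omega)
    choose m' hm1 _ hm3 using hb'
    refine exists_flash_of_path hval hpar (b := b') (m := m') (by simp [prof, h0']) hm3 ?_
    exact hm'.mono 0 fun n _ h => by rw [hm1] at h; exact Option.some.inj h

end MarkedPaths

theorem lcp_step {a b i j : ℕ} (hi : i ≤ 1) (hj : j ≤ 1) (hj0 : b = 0 → j = 0)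
    (h : 2 * a + i < 2 * b + j) :
    (a < b ∧ lcp (2 * a + i) (2 * b + j) = lcp a b) ∨
      (a = b ∧ a ≠ 0 ∧ lcp (2 * a + i) (2 * b + j) = a) := by
  by_cases hab : a = b
  · subst hab
    obtain rfl : i = 0 := by omega
    obtain rfl : j = 1 := by omega
    exact Or.inr ⟨rfl, by omega, lcp_siblings a⟩
  · exact Or.inl ⟨by omega, lcp_double hab hi hj⟩

/-- Two profiles that compare states and branching nodes in the same way. -/
def ProfileEquiv {S : Type} (p q : S → ℕ) : Prop :=
  (∀ s t, p s ≤ p t ↔ q s ≤ q t) ∧ ∀ s t x y, p s < p t → p x < p y →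
    (lcp (p s) (p t) ≤ lcp (p x) (p y) ↔ lcp (q s) (q t) ≤ lcp (q x) (q y))

namespace ProfileEquiv

variable {S : Type} {p q : S → ℕ}

theorem lt_iff (h : ProfileEquiv p q) (s t : S) : p s < p t ↔ q s < q t := by
  rw [← not_le, ← not_le, h.1]

theorem eq_iff (h : ProfileEquiv p q) (s t : S) : p s = p t ↔ q s = q t := by
  rw [le_antisymm_iff, le_antisymm_iff, h.1, h.1]

theorem symm (h : ProfileEquiv p q) : ProfileEquiv q p :=
  ⟨fun s t => (h.1 s t).symm, fun s t x y hst hxy =>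
    (h.2 s t x y ((h.lt_iff s t).mpr hst) ((h.lt_iff x y).mpr hxy)).symm⟩

theorem lcp_eq_iff (h : ProfileEquiv p q) {s t x y : S} (hst : p s < p t) (hxy : p x < p y) :
    lcp (p s) (p t) = lcp (p x) (p y) ↔ lcp (q s) (q t) = lcp (q x) (q y) := by
  rw [le_antisymm_iff, le_antisymm_iff, h.2 s t x y hst hxy, h.2 x y s t hxy hst]

theorem isLeastAbove_iff (h : ProfileEquiv p q) {s t : S} (hst : p s < p t) (x : S) :
    IsLeastAbove p x (lcp (p s) (p t)) ↔ IsLeastAbove q x (lcp (q s) (q t)) := by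
  unfold IsLeastAbove
  refine and_congr (exists_congr fun r => ?_) (forall_congr' fun r => ?_)
  · rw [← h.lt_iff]
    exact and_congr_right fun hr => h.lcp_eq_iff hr hst
  · rw [← h.lt_iff]
    exact forall_congr' fun hr => h.2 r x s t hr hst

variable [Fintype S] {z : S} {n n' : ℕ}

theorem rank_eq (h : ProfileEquiv p q) {s t : S} (hst : p s < p t) :
    rank p (lcp (p s) (p t)) = rank q (lcp (q s) (q t)) := by
  have key : ∀ {p q : S → ℕ}, ProfileEquiv p q → p s < p t →
      rank p (lcp (p s) (p t)) ≤ rank q (lcp (q s) (q t)) := by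
    intro p q h hst
    have hex : ∀ u, ∃ v, u ∈ (branch p).filter (· < lcp (p s) (p t)) →
        ∃ x y, p x < p y ∧ lcp (p x) (p y) = u ∧ lcp (q x) (q y) = v := by
      intro u
      by_cases hu : u ∈ (branch p).filter (· < lcp (p s) (p t))
      · obtain ⟨x, y, hxy, hl⟩ := mem_branch.mp (Finset.mem_filter.mp hu).1
        exact ⟨_, fun _ => ⟨x, y, hxy, hl, rfl⟩⟩
      · exact ⟨0, fun h => absurd h hu⟩
    choose f hf using hex
    refine Finset.card_le_card_of_injOn f (fun u hu => ?_) fun u hu v hv huv => ?_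
    · obtain ⟨x, y, hxy, hl, hv⟩ := hf u hu
      have hlt := (Finset.mem_filter.mp hu).2
      simp only [Finset.coe_filter, Set.mem_ofPred_eq]
      rw [← hv, mem_branch]
      refine ⟨⟨x, y, (h.lt_iff x y).mp hxy, rfl⟩, ?_⟩
      rw [← hl] at hlt
      rw [← not_le] at hlt ⊢
      rwa [← h.2 s t x y hst hxy]
    · obtain ⟨x, y, hxy, hl, hfu⟩ := hf u hu
      obtain ⟨x', y', hxy', hl', hfv⟩ := hf v hv
      rw [← hl, ← hl', h.lcp_eq_iff hxy hxy', hfu, hfv, huv]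
  exact le_antisymm (key h hst) (key h.symm ((h.lt_iff s t).mp hst))

theorem mem_branch_pstep_iff (hp : ValidProfile z n p) {p' : S → ℕ} {par : S → S} {bit : S → ℕ}
    (hpar : ∀ y, bit y ≤ 1 ∧ (p (par y) = 0 → bit y = 0) ∧ p' y = 2 * p (par y) + bit y)
    {s t : S} (hst : p s < p t) : lcp (p s) (p t) ∈ branch p' ↔
      ∃ x y, p (par x) < p (par y) ∧ lcp (p (par x)) (p (par y)) = lcp (p s) (p t) := by
  rw [mem_branch]
  refine exists_congr fun x => exists_congr fun y => ?_
  obtain ⟨hx1, -, hx⟩ := hpar x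
  obtain ⟨hy1, hy0, hy⟩ := hpar y
  rw [hx, hy]
  constructor
  · rintro ⟨hlt, hl⟩
    rcases lcp_step hx1 hy1 hy0 hlt with ⟨h1, h2⟩ | ⟨h1, h2, h3⟩
    · exact ⟨h1, h2 ▸ hl⟩
    · have h4 := lt_of_mem_branch hp (mem_branch.mpr ⟨s, t, hst, rfl⟩)
      have h5 := hp.2 (par x)
      omega
  · rintro ⟨hlt, hl⟩
    exact ⟨by omega, (lcp_double hlt.ne hx1 hy1).trans hl⟩

theorem weight_eq (h : ProfileEquiv p q) (hp : ValidProfile z n p) (hq : ValidProfile z n' q)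
    (e : S → S → Option Bool) {s t : S} (hst : p s < p t) :
    weight p (pstep e p) (lcp (p s) (p t)) = weight q (pstep e q) (lcp (q s) (q t)) := by
  obtain ⟨par, bit, hpar⟩ := exists_parents h.1 hp.1 hq.1 e
  have hpz : ∀ s, p s = 0 ↔ q s = 0 := fun s => by
    have := h.eq_iff s z
    rwa [hp.1, hq.1] at this
  have hbr : lcp (p s) (p t) ∈ branch (pstep e p) ↔ lcp (q s) (q t) ∈ branch (pstep e q) := by
    rw [mem_branch_pstep_iff hp (fun y => ⟨(hpar y).1, (hpar y).2.1, (hpar y).2.2.1⟩) hst,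
      mem_branch_pstep_iff hq (fun y => ⟨(hpar y).1, fun h0 => (hpar y).2.1 ((hpz _).mpr h0),
        (hpar y).2.2.2⟩) ((h.lt_iff s t).mp hst)]
    refine exists_congr fun x => exists_congr fun y => ?_
    rw [← h.lt_iff]
    exact and_congr_right fun hxy => h.lcp_eq_iff hxy hst
  have hfl : Flash p (pstep e p) (lcp (p s) (p t)) ↔ Flash q (pstep e q) (lcp (q s) (q t)) := by
    unfold Flash
    refine exists_congr fun x => and_congr (h.isLeastAbove_iff hst x) (forall_congr' fun y => ?_)
    obtain ⟨h1, -, h2, h3⟩ := hpar y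
    have := h.eq_iff (par y) x
    rw [h2, h3]
    omega
  unfold weight
  rw [h.rank_eq hst]
  split_ifs <;> tauto

theorem priority_eq (h : ProfileEquiv p q) (hp : ValidProfile z n p) (hq : ValidProfile z n' q)
    (e : S → S → Option Bool) : priority p (pstep e p) = priority q (pstep e q) := by
  have key : ∀ {p q : S → ℕ} {n n' : ℕ}, ProfileEquiv p q → ValidProfile z n p →
      ValidProfile z n' q → priority p (pstep e p) ≤ priority q (pstep e q) := by
    intro p q n n' h hp hq
    refine Finset.sup_le fun u hu => ?_
    obtain ⟨s, t, hst, rfl⟩ := mem_branch.mp hu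
    rw [h.weight_eq hp hq e hst]
    exact weight_le_priority (mem_branch.mpr ⟨s, t, (h.lt_iff s t).mp hst, rfl⟩)
  exact le_antisymm (key h hp hq) (key h.symm hq hp)

theorem pstep (h : ProfileEquiv p q) (hp : ValidProfile z n p) (hq : ValidProfile z n' q)
    (e : S → S → Option Bool) : ProfileEquiv (pstep e p) (pstep e q) := by
  obtain ⟨par, bit, hpar⟩ := exists_parents h.1 hp.1 hq.1 e
  have hpz : ∀ s, p s = 0 ↔ q s = 0 := fun s => by
    have := h.eq_iff s z
    rwa [hp.1, hq.1] at this
  have hle : ∀ s t, GFGPaper.pstep e p s ≤ GFGPaper.pstep e p t ↔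
      GFGPaper.pstep e q s ≤ GFGPaper.pstep e q t := by
    intro s t
    obtain ⟨hs1, -, hs2, hs3⟩ := hpar s
    obtain ⟨ht1, -, ht2, ht3⟩ := hpar t
    have h1 := h.1 (par s) (par t)
    have h2 := h.1 (par t) (par s)
    rw [hs2, hs3, ht2, ht3]
    omega
  have hlcp : ∀ s t, GFGPaper.pstep e p s < GFGPaper.pstep e p t →
      (p (par s) < p (par t) ∧
        lcp (GFGPaper.pstep e p s) (GFGPaper.pstep e p t) = lcp (p (par s)) (p (par t)) ∧
        lcp (GFGPaper.pstep e q s) (GFGPaper.pstep e q t) = lcp (q (par s)) (q (par t))) ∨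
      (2 ^ n ≤ p (par s) ∧ 2 ^ n' ≤ q (par s) ∧
        lcp (GFGPaper.pstep e p s) (GFGPaper.pstep e p t) = p (par s) ∧
        lcp (GFGPaper.pstep e q s) (GFGPaper.pstep e q t) = q (par s)) := by
    intro s t hst
    have hst' := hst
    rw [← not_le, hle, not_le] at hst'
    obtain ⟨hs1, -, hs2, hs3⟩ := hpar s
    obtain ⟨ht1, ht0, ht2, ht3⟩ := hpar t
    rw [hs2, ht2] at hst ⊢
    rw [hs3, ht3] at hst' ⊢
    have heq := h.eq_iff (par s) (par t)
    rcases lcp_step hs1 ht1 ht0 hst with ⟨h1, h2⟩ | ⟨h1, h2, h3⟩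
    · rcases lcp_step hs1 ht1 (fun h0 => ht0 ((hpz _).mpr h0)) hst' with ⟨-, h5⟩ | ⟨h4, -⟩
      · exact Or.inl ⟨h1, h2, h5⟩
      · omega
    · rcases lcp_step hs1 ht1 (fun h0 => ht0 ((hpz _).mpr h0)) hst' with ⟨h4, -⟩ | ⟨-, h5, h6⟩
      · omega
      · exact Or.inr ⟨((hp.2 _).resolve_left h2).1, ((hq.2 _).resolve_left h5).1, h3, h6⟩
  refine ⟨hle, fun s t x y hst hxy => ?_⟩
  have hbound : ∀ s t, p s < p t → lcp (p s) (p t) < 2 ^ n ∧ lcp (q s) (q t) < 2 ^ n' :=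
    fun s t hst => ⟨lt_of_mem_branch hp (mem_branch.mpr ⟨s, t, hst, rfl⟩),
      lt_of_mem_branch hq (mem_branch.mpr ⟨s, t, (h.lt_iff s t).mp hst, rfl⟩)⟩
  rcases hlcp s t hst with ⟨h1, h2, h3⟩ | ⟨h1, h2, h3, h4⟩ <;>
    rcases hlcp x y hxy with ⟨h5, h6, h7⟩ | ⟨h5, h6, h7, h8⟩
  · rw [h2, h3, h6, h7]
    exact h.2 _ _ _ _ h1 h5
  · have := hbound _ _ h1
    rw [h2, h3, h7, h8]
    omega
  · have := hbound _ _ h5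
    rw [h3, h4, h6, h7]
    omega
  · rw [h3, h4, h7, h8]
    exact h.1 _ _

end ProfileEquiv

section Code

variable {S : Type} [Fintype S]

/-- The relative position of the values of `f`. -/
def position (f : S → ℕ) (s : S) : Fin (Fintype.card S + 1) :=
  ⟨(Finset.univ.filter fun t => f t < f s).card, Nat.lt_succ_of_le (Finset.card_filter_le _ _)⟩

theorem position_le_iff (f : S → ℕ) (s t : S) : position f s ≤ position f t ↔ f s ≤ f t := by
  constructor
  · intro h
    by_contra hlt
    refine absurd h (not_le.mpr ?_)
    rw [not_le] at hlt
    refine Fin.mk_lt_mk.mpr (Finset.card_lt_card (Finset.ssubset_iff_subset_ne.mpr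
      ⟨fun r hr => ?_, fun heq => ?_⟩))
    · simp only [Finset.mem_filter] at hr ⊢
      exact ⟨hr.1, hr.2.trans hlt⟩
    · have : t ∈ Finset.univ.filter fun r => f r < f s := by simpa using hlt
      rw [← heq] at this
      simp at this
  · intro h
    refine Fin.mk_le_mk.mpr (Finset.card_le_card fun r hr => ?_)
    simp only [Finset.mem_filter] at hr ⊢
    exact ⟨hr.1, hr.2.trans_le h⟩

theorem position_eq_iff {f g : S → ℕ} :
    position f = position g ↔ ∀ s t, f s ≤ f t ↔ g s ≤ g t := by
  constructor
  · intro h s t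
    rw [← position_le_iff, h, position_le_iff]
  · intro h
    funext s
    simp only [position, ← not_le, h]

/-- The height of the highest branching node between the value of `s` and a smaller one. -/
def nodeHeight (p : S → ℕ) (s : S) : ℕ :=
  (Finset.univ.filter fun r => p r < p s).sup fun r => lcp (p r) (p s) + 1

theorem nodeHeight_le_iff (p : S → ℕ) (s t : S) : nodeHeight p s ≤ nodeHeight p t ↔
    ∀ r, p r < p s → ∃ r', p r' < p t ∧ lcp (p r) (p s) ≤ lcp (p r') (p t) := by
  unfold nodeHeight
  simp only [Finset.sup_le_iff, Finset.mem_filter, Finset.mem_univ, true_and]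
  refine forall_congr' fun r => forall_congr' fun _ => ?_
  rw [Finset.le_sup_iff (Nat.succ_pos _)]
  simp

theorem lcp_lt_nodeHeight {p : S → ℕ} {s t x : S} (h1 : p s < p x) (h2 : p x ≤ p t) :
    lcp (p s) (p t) < nodeHeight p x := by
  have h3 := lcp_le_of_le h1 h2
  have h4 : lcp (p s) (p x) + 1 ≤ nodeHeight p x :=
    Finset.le_sup (f := fun r => lcp (p r) (p x) + 1) (by simpa using h1)
  omega

theorem exists_nodeHeight_le {p : S → ℕ} {s t : S} (h : p s < p t) :
    ∃ x, p s < p x ∧ p x ≤ p t ∧ nodeHeight p x ≤ lcp (p s) (p t) + 1 := by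
  obtain ⟨d, hs, ht⟩ := exists_div_pow_of_lt h
  obtain ⟨x, hx, hmin⟩ := Set.exists_min_image {x | p x / 2 ^ d = 2 * lcp (p s) (p t) + 1} p
    (Set.toFinite _) ⟨t, ht⟩
  have hx' : p x / 2 ^ d = 2 * lcp (p s) (p t) + 1 := hx
  refine ⟨x, lt_of_div_pow_lt (d := d) (by omega), hmin t ht, Finset.sup_le fun r hr => ?_⟩
  have hr' : p r < p x := (Finset.mem_filter.mp hr).2
  exact Nat.succ_le_succ (lcp_le_of_div_pow hx' hr' fun h => absurd (hmin r h) (not_le.mpr hr'))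

theorem lcp_le_iff_nodeHeight {p : S → ℕ} {s t x y : S} (hst : p s < p t) (hxy : p x < p y) :
    lcp (p s) (p t) ≤ lcp (p x) (p y) ↔ ∀ y', p x < p y' → p y' ≤ p y →
      ∃ t', p s < p t' ∧ p t' ≤ p t ∧ nodeHeight p t' ≤ nodeHeight p y' := by
  constructor
  · intro h y' h1 h2
    obtain ⟨t', h3, h4, h5⟩ := exists_nodeHeight_le hst
    have := lcp_lt_nodeHeight h1 h2
    exact ⟨t', h3, h4, by omega⟩
  · intro h
    obtain ⟨y', h1, h2, h3⟩ := exists_nodeHeight_le hxy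
    obtain ⟨t', h4, h5, h6⟩ := h y' h1 h2
    have := lcp_lt_nodeHeight h4 h5
    omega

/-- The finite abstraction of a profile. -/
def code (p : S → ℕ) : (S → Fin (Fintype.card S + 1)) × (S → Fin (Fintype.card S + 1)) :=
  (position p, position (nodeHeight p))

theorem code_eq_iff {p q : S → ℕ} : code p = code q ↔ ProfileEquiv p q := by
  rw [code, code, Prod.mk.injEq, position_eq_iff, position_eq_iff, ProfileEquiv]
  refine and_congr_right fun hle => ?_
  have hlt : ∀ s t, p s < p t ↔ q s < q t := fun s t => by rw [← not_le, ← not_le, hle]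
  constructor
  · intro h s t x y hst hxy
    rw [lcp_le_iff_nodeHeight hst hxy,
      lcp_le_iff_nodeHeight ((hlt s t).mp hst) ((hlt x y).mp hxy)]
    simp only [h, hle, hlt]
  · intro h s t
    rw [nodeHeight_le_iff, nodeHeight_le_iff]
    refine forall_congr' fun r => ?_
    rw [hlt]
    refine forall_congr' fun hr => exists_congr fun r' => ?_
    rw [hlt]
    exact and_congr_right fun hr' => h _ _ _ _ ((hlt _ _).mpr hr) ((hlt _ _).mpr hr')

end Code

open Classical in
/-- The one-step graph of the nondeterministic Büchi automaton that looks for a rejecting path: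
from the phase `0` it may guess the odd priority that dominates the rest of the path, whose
occurrences are then marked. -/
noncomputable def guessBox {A Q : Type} (M : APW A Q) (k : ℕ) (a : A)
    (c : (q : Q) → EveChoice (M.δ q a)) : Option (Q × Fin k) → Option (Q × Fin k) → Option Bool
  | some (q, i), some (q', j) =>
    if q' ∈ (c q).outcome then
      if i.val = 0 then some false
      else if j = i ∧ Odd i.val ∧ M.prio q a q' ≤ i then some (decide (M.prio q a q' = i))
      else none
    else none
  | _, _ => none

section GuessBox

variable {A Q : Type} (M : APW A Q) (k : ℕ)

theorem guessBox_none (a : A) (c : (q : Q) → EveChoice (M.δ q a)) (x : Option (Q × Fin k)) :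
    guessBox M k a c x none = none := by
  cases x <;> rfl

theorem guessBox_eq_some_iff (a : A) (c : (q : Q) → EveChoice (M.δ q a)) (q q' : Q) (i j : Fin k)
    (v : Bool) : guessBox M k a c (some (q, i)) (some (q', j)) = some v ↔
      q' ∈ (c q).outcome ∧ ((i.val = 0 ∧ v = false) ∨
        (i.val ≠ 0 ∧ j = i ∧ Odd i.val ∧ M.prio q a q' ≤ i ∧
          v = decide (M.prio q a q' = i))) := by
  simp only [guessBox]
  split_ifs with h1 h2 h3
  · simp [h1, h2, eq_comm]
  · simp [h1, h2, h3, eq_comm]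
  · simp only [false_iff]
    tauto
  · simp [h1]

theorem exists_guess_iff (hk : 0 < k) (hM : ∀ q a q', M.prio q a q' < k) (w : ℕ → A)
    (c : (n : ℕ) → (q : Q) → EveChoice (M.δ q (w n))) :
    (∃ (b : ℕ → Option (Q × Fin k)) (m : ℕ → Bool), b 0 = some (M.init, ⟨0, hk⟩) ∧
      (∀ n, guessBox M k (w n) (c n) (b n) (b (n + 1)) = some (m n)) ∧
      InfOften fun n => m n = true) ↔
    ∃ ρ : ℕ → Q, ρ 0 = M.init ∧ (∀ n, ρ (n + 1) ∈ (c n (ρ n)).outcome) ∧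
      ¬ ParityAcc fun n => M.prio (ρ n) (w n) (ρ (n + 1)) := by
  constructor
  · rintro ⟨b, m, hb0, hb, hm⟩
    have hsome : ∀ n, ∃ x, b n = some x := by
      rintro (_ | n)
      · exact ⟨_, hb0⟩
      · cases h : b (n + 1) with
        | none => have := hb n; rw [h, guessBox_none] at this; simp at this
        | some x => exact ⟨x, rfl⟩
    choose x hx using hsome
    have hstep : ∀ n, (x (n + 1)).1 ∈ (c n (x n).1).outcome ∧
        (((x n).2.val = 0 ∧ m n = false) ∨ ((x n).2.val ≠ 0 ∧ (x (n + 1)).2 = (x n).2 ∧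
          Odd (x n).2.val ∧ M.prio (x n).1 (w n) (x (n + 1)).1 ≤ (x n).2 ∧
          m n = decide (M.prio (x n).1 (w n) (x (n + 1)).1 = (x n).2))) := by
      intro n
      have := hb n
      rw [hx, hx] at this
      exact (guessBox_eq_some_iff ..).mp this
    refine ⟨fun n => (x n).1, ?_, fun n => (hstep n).1, ?_⟩
    · rw [hx] at hb0
      exact congrArg Prod.fst (Option.some.inj hb0)
    · obtain ⟨N, -, hN⟩ := hm 0
      have hN0 : (x N).2.val ≠ 0 := by
        rcases (hstep N).2 with h | h
        · simp [h.2] at hN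
        · exact h.1
      have hmode : ∀ n, N ≤ n → (x n).2 = (x N).2 := by
        intro n hn
        induction n, hn using Nat.le_induction with
        | base => rfl
        | succ n _ ih =>
          rcases (hstep n).2 with h | h
          · exact absurd (ih ▸ h.1) hN0
          · exact h.2.1.trans ih
      have hstep' : ∀ n, N ≤ n → Odd (x N).2.val ∧
          M.prio (x n).1 (w n) (x (n + 1)).1 ≤ (x N).2 ∧
          m n = decide (M.prio (x n).1 (w n) (x (n + 1)).1 = (x N).2) := by
        intro n hn
        rcases (hstep n).2 with h | h
        · exact absurd (hmode n hn ▸ h.1) hN0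
        · exact hmode n hn ▸ h.2.2
      refine not_parityAcc_of_odd (hstep' N le_rfl).1
        (hm.mono N fun n hn hmn => ?_) fun q => not_infOften_of_le fun n hn => (hstep' n hn).2.1
      simpa [(hstep' n hn).2.2] using hmn
  · rintro ⟨ρ, hρ0, hρ, hacc⟩
    obtain ⟨p, hp, N, hN⟩ := exists_max_infOften (N := 0)
      (c := fun n => M.prio (ρ n) (w n) (ρ (n + 1))) (K := k) fun n _ => hM _ _ _
    have hodd : Odd p := by
      rw [← Nat.not_even_iff_odd]
      exact fun he => hacc ⟨p, he, hp, fun q => not_infOften_of_le hN⟩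
    have hpk : p < k := by
      obtain ⟨n, -, hn⟩ := hp 0
      exact hn ▸ hM _ _ _
    refine ⟨fun n => some (ρ n, if n ≤ N then ⟨0, hk⟩ else ⟨p, hpk⟩),
      fun n => if n ≤ N then false else decide (M.prio (ρ n) (w n) (ρ (n + 1)) = p), ?_, ?_, ?_⟩
    · simp [hρ0]
    · intro n
      rw [guessBox_eq_some_iff]
      refine ⟨hρ n, ?_⟩
      by_cases h : n ≤ N
      · simp [h]
      · have h1 : ¬ n + 1 ≤ N := by omega
        have := hN n (by omega)
        simp [h, h1, hodd, hodd.pos.ne', this]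
    · refine hp.mono (N + 1) fun n hn h => ?_
      have h1 : ¬ n ≤ N := by omega
      simp [h1, h]

end GuessBox

section BoxAutomaton

variable {A Q : Type} [Fintype Q] (M : APW A Q) (k : ℕ) (hk : 0 < k)

/-- States of the automaton `A^□`: a profile up to equivalence and the last priority. -/
abbrev BoxState (Q : Type) [Fintype Q] (k : ℕ) : Type :=
  ((Option (Q × Fin k) → Fin (Fintype.card (Option (Q × Fin k)) + 1)) ×
    (Option (Q × Fin k) → Fin (Fintype.card (Option (Q × Fin k)) + 1))) ×
    Fin (2 * Fintype.card (Option (Q × Fin k) × Option (Q × Fin k)) + 3)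

/-- The state of `A^□` reached by a transition between two profiles. -/
noncomputable def boxState (p p' : Option (Q × Fin k) → ℕ) : BoxState Q k :=
  (code p', ⟨priority p p', priority_lt p p'⟩)

/-- The automaton `A^□`, which guesses a box for each letter and checks with a deterministic
parity automaton that the sequence of boxes is universally accepting. -/
noncomputable def boxAutomaton : NPA A (BoxState Q k) where
  init := (code (prof (some (M.init, ⟨0, hk⟩)) (fun _ _ _ => none) 0), 0)
  Δ := fun x a => {y | ∃ (n : ℕ) (p : Option (Q × Fin k) → ℕ) (c : (q : Q) → EveChoice (M.δ q a)),
    ValidProfile none n p ∧ code p = x.1 ∧ y = boxState k p (pstep (guessBox M k a c) p)}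
  prio := fun _ _ y => y.2

theorem parityAcc_guess_iff (hM : ∀ q a q', M.prio q a q' < k) (w : ℕ → A)
    (c : (n : ℕ) → (q : Q) → EveChoice (M.δ q (w n))) :
    ParityAcc (fun n =>
      priority (prof (some (M.init, ⟨0, hk⟩)) (fun n => guessBox M k (w n) (c n)) n)
        (prof (some (M.init, ⟨0, hk⟩)) (fun n => guessBox M k (w n) (c n)) (n + 1))) ↔
    ∀ ρ : ℕ → Q, ρ 0 = M.init → (∀ n, ρ (n + 1) ∈ (c n (ρ n)).outcome) →
      ParityAcc fun n => M.prio (ρ n) (w n) (ρ (n + 1)) := by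
  rw [parityAcc_prof_iff (z := none) (by simp) fun n => guessBox_none M k (w n) (c n),
    exists_guess_iff M k hk hM]
  push Not
  rfl

theorem accepts_of_boxAutomaton_accepts (hM : ∀ q a q', M.prio q a q' < k) {w : ℕ → A}
    (h : (boxAutomaton M k hk).Accepts w) : M.Accepts w := by
  obtain ⟨x, ⟨hx0, hx⟩, hacc⟩ := h
  choose n p c hp hpx hxp using hx
  have hprof := validProfile_prof (s₀ := some (M.init, (⟨0, hk⟩ : Fin k))) (z := none)
    (e := fun n => guessBox M k (w n) (c n)) (by simp)
    fun n => guessBox_none M k (w n) (c n)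
  have hcode : ∀ i, (x i).1 =
      code (prof (some (M.init, ⟨0, hk⟩)) (fun n => guessBox M k (w n) (c n)) i) := by
    intro i
    induction i with
    | zero => rw [hx0]; rfl
    | succ i ih =>
      rw [hxp i]
      exact code_eq_iff.mpr ((code_eq_iff.mp ((hpx i).trans ih)).pstep (hp i) (hprof i) _)
  have hprio : ∀ i, ((x (i + 1)).2 : ℕ) =
      priority (prof (some (M.init, ⟨0, hk⟩)) (fun n => guessBox M k (w n) (c n)) i)
        (prof (some (M.init, ⟨0, hk⟩)) (fun n => guessBox M k (w n) (c n)) (i + 1)) := by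
    intro i
    rw [hxp i]
    exact (code_eq_iff.mp ((hpx i).trans (hcode i))).priority_eq (hp i) (hprof i) _
  refine ⟨fun _ n q => c n q, fun ρ hρ0 hρ => (parityAcc_guess_iff M k hk hM w c).mp ?_ ρ hρ0 hρ⟩
  simpa only [boxAutomaton, hprio] using hacc

/-- The profile reached when Eve plays the strategy `τ`, on the reversed word. -/
noncomputable def stratProfile (τ : List A → (a : A) → (q : Q) → EveChoice (M.δ q a)) :
    List A → Option (Q × Fin k) → ℕ
  | [] => prof (some (M.init, ⟨0, hk⟩)) (fun _ _ _ => none) 0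
  | a :: u => pstep (guessBox M k a (τ u.reverse a)) (stratProfile τ u)

/-- The state of `A^□` reached when Eve plays the strategy `τ`, on the reversed word. -/
noncomputable def stratState (τ : List A → (a : A) → (q : Q) → EveChoice (M.δ q a)) :
    List A → BoxState Q k
  | [] => (boxAutomaton M k hk).init
  | a :: u => boxState k (stratProfile M k hk τ u) (stratProfile M k hk τ (a :: u))

variable (τ : List A → (a : A) → (q : Q) → EveChoice (M.δ q a))

theorem validProfile_stratProfile (u : List A) :
    ValidProfile none u.length (stratProfile M k hk τ u) := by
  induction u with
  | nil => exact validProfile_prof (by simp) (fun _ _ => rfl) 0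
  | cons a u ih => exact ih.pstep (guessBox_none M k a _)

theorem code_stratProfile (u : List A) :
    code (stratProfile M k hk τ u) = (stratState M k hk τ u).1 := by
  cases u <;> rfl

theorem stratProfile_reverse_pref (w : ℕ → A) (n : ℕ) :
    stratProfile M k hk τ (pref w n).reverse = prof (some (M.init, ⟨0, hk⟩))
      (fun n => guessBox M k (w n) (τ (pref w n) (w n))) n := by
  induction n with
  | zero => rfl
  | succ n ih =>
    rw [pref_succ, List.reverse_append, List.reverse_singleton, List.singleton_append,
      stratProfile, ih, List.reverse_reverse]
    rfl

theorem stratState_mem (u : List A) (a : A) : stratState M k hk τ (u ++ [a]).reverse ∈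
    (boxAutomaton M k hk).Δ (stratState M k hk τ u.reverse) a := by
  rw [List.reverse_append, List.reverse_singleton, List.singleton_append]
  exact ⟨_, stratProfile M k hk τ u.reverse, τ u.reverse.reverse a,
    validProfile_stratProfile M k hk τ _, code_stratProfile M k hk τ _, rfl⟩

theorem parityAcc_stratState (hM : ∀ q a q', M.prio q a q' < k) {w : ℕ → A}
    (hτ : ∀ ρ : ℕ → Q, ρ 0 = M.init → (∀ n, ρ (n + 1) ∈ (τ (pref w n) (w n) (ρ n)).outcome) →
      ParityAcc fun n => M.prio (ρ n) (w n) (ρ (n + 1))) :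
    ParityAcc fun n => (boxAutomaton M k hk).prio (stratState M k hk τ (pref w n).reverse) (w n)
      (stratState M k hk τ (pref w (n + 1)).reverse) := by
  convert (parityAcc_guess_iff M k hk hM w fun n => τ (pref w n) (w n)).mpr hτ using 2 with n
  rw [← stratProfile_reverse_pref, ← stratProfile_reverse_pref, pref_succ, List.reverse_append,
    List.reverse_singleton, List.singleton_append]
  rfl

theorem boxAutomaton_gfg (hM : ∀ q a q', M.prio q a q' < k) (h : EveWinsPositional M.toAlt) :
    (∀ w, (boxAutomaton M k hk).Accepts w ↔ M.Accepts w) ∧ (boxAutomaton M k hk).GFG := by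
  obtain ⟨τ, hτ⟩ := h
  let τ' : List A → (a : A) → (q : Q) → EveChoice (M.δ q a) := τ
  have hacc : ∀ w, M.Accepts w → ParityAcc fun n => (boxAutomaton M k hk).prio
      (stratState M k hk τ' (pref w n).reverse) (w n)
      (stratState M k hk τ' (pref w (n + 1)).reverse) := fun w hw =>
    parityAcc_stratState M k hk τ' hM fun ρ hρ0 hρ => hτ w ρ hρ0 hρ hw
  have hsound := fun w => accepts_of_boxAutomaton_accepts M k hk hM (w := w)
  refine ⟨fun w => ⟨hsound w, fun hw => ⟨fun n => stratState M k hk τ' (pref w n).reverse,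
    ⟨rfl, fun n => ?_⟩, hacc w hw⟩⟩, fun u => stratState M k hk τ' u.reverse, rfl,
    stratState_mem M k hk τ', fun w hw => hacc w (hsound w hw)⟩
  dsimp only
  rw [pref_succ]
  exact stratState_mem M k hk τ' _ _

open Classical in
theorem card_boxState_le (hQ : 0 < Fintype.card Q) (hk : 0 < k) :
    Fintype.card (BoxState Q k) ≤
      2 ^ (14 * (Fintype.card Q * k) * (Nat.log 2 (Fintype.card Q * k) + 1)) := by
  set N := Fintype.card Q * k with hN
  set L := Nat.log 2 N + 1
  have hNpos : 0 < N := Nat.mul_pos hQ hk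
  have hcard : Fintype.card (Option (Q × Fin k)) = N + 1 := by simp [hN]
  have hNL : N < 2 ^ L := Nat.lt_pow_succ_log_self one_lt_two N
  have hbase : N + 2 ≤ 2 ^ (2 * L) := by
    rw [mul_comm, pow_mul]
    nlinarith
  have hprio : 2 * ((N + 1) * (N + 1)) + 3 ≤ (N + 2) ^ 3 := by nlinarith [sq_nonneg N]
  calc Fintype.card (BoxState Q k)
      = (N + 2) ^ (2 * (N + 1)) * (2 * ((N + 1) * (N + 1)) + 3) := by
        simp only [BoxState, Fintype.card_prod, Fintype.card_fun, Fintype.card_fin, hcard]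
        ring
    _ ≤ (N + 2) ^ (2 * (N + 1)) * (N + 2) ^ 3 := Nat.mul_le_mul_left _ hprio
    _ = (N + 2) ^ (2 * N + 5) := by rw [← pow_add, mul_add]
    _ ≤ (2 ^ (2 * L)) ^ (2 * N + 5) := Nat.pow_le_pow_left hbase _
    _ = 2 ^ (2 * L * (2 * N + 5)) := (pow_mul ..).symm
    _ ≤ 2 ^ (14 * N * L) := Nat.pow_le_pow_right two_pos (by nlinarith)

end BoxAutomaton

end GFGPaper

namespace GFGPaper

/-- every alternating parity GFG automaton with `n` states and
parity index `k` is equivalent to a nondeterministic parity GFG automaton with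
`2^{O(nk log nk)}` states. -/
theorem gfg_alternating_to_gfg_nondeterministic :
    ∃ C : ℕ, ∀ (A Q : Type) (iQ : Fintype Q) (M : APW A Q) (k : ℕ),
      0 < k → (∀ q a q', M.prio q a q' < k) →
      ExistsGFG M.toAlt → ForallGFG M.toAlt →
      ∃ (P : Type) (iP : Fintype P) (N : NPA A P),
        (∀ w, N.Accepts w ↔ M.Accepts w) ∧ N.GFG ∧
        @Fintype.card P iP ≤
          2 ^ (C * (@Fintype.card Q iQ * k) *
               (Nat.log 2 (@Fintype.card Q iQ * k) + 1)) := by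
  refine ⟨14, fun A Q iQ M k hk hM hE _ => ?_⟩
  obtain ⟨hL, hG⟩ := boxAutomaton_gfg M k hk hM (eveWinsPositional_of_existsGFG M hM hE)
  classical
  exact ⟨BoxState Q k, inferInstance, boxAutomaton M k hk, hL, hG,
    card_boxState_le k (Fintype.card_pos_iff.mpr ⟨M.init⟩) hk⟩

end GFGPaper
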